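/- Let d ≥ 2 and let P ⊆ ℝ^d be a full-dimensional bipartite polytope whose two radii coincide (r1 = r2, i.e. all vertices of P lie on a common sphere centered at the origin). Then P is a Γ-permutahedron: there exist a finite reflection group Γ of ℝ^d and a point v ∈ ℝ^d generic for Γ such that P is the convex hull of the orbit {T(v) : T ∈ Γ}. -/

import Mathlib

open Set Pointwise

noncomputable section

/-- Euclidean space `ℝ^d`. -/
abbrev Euc (d : ℕ) := EuclideanSpace ℝ (Fin d)

/-- A convex polytope: the convex hull of a finite set of points. -/
def IsPolytope {d : ℕ} (P : Set (Euc d)) : Prop :=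
  ∃ S : Finset (Euc d), P = convexHull ℝ (S : Set (Euc d))

/-- `P` is full-dimensional: its affine span is all of `ℝ^d`. -/
def FullDim {d : ℕ} (P : Set (Euc d)) : Prop :=
  affineSpan ℝ P = ⊤

/-- `[v,w]` is an edge of `P`: an exposed face of `P` which is a segment with `v ≠ w`. -/
def IsEdge {d : ℕ} (P : Set (Euc d)) (v w : Euc d) : Prop :=
  v ≠ w ∧ IsExposed ℝ P (segment ℝ v w)

/-- `e` is an edge of `P`, as a set. -/
def IsEdgeSet {d : ℕ} (P e : Set (Euc d)) : Prop :=
  ∃ v w : Euc d, IsEdge P v w ∧ e = segment ℝ v w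

/-- `T` is a symmetry of `P`: a linear isometry mapping `P` onto itself. -/
def IsAut {d : ℕ} (P : Set (Euc d)) (T : Euc d ≃ₗᵢ[ℝ] Euc d) : Prop :=
  T '' P = P

/-- `P` is vertex-transitive: any vertex (extreme point) can be mapped onto any
other by a symmetry of `P`. -/
def VertexTransitive {d : ℕ} (P : Set (Euc d)) : Prop :=
  ∀ v ∈ Set.extremePoints ℝ P, ∀ w ∈ Set.extremePoints ℝ P,
    ∃ T : Euc d ≃ₗᵢ[ℝ] Euc d, IsAut P T ∧ T v = w

/-- `P` is edge-transitive: any edge can be mapped onto any other by a symmetry of `P`. -/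
def EdgeTransitive {d : ℕ} (P : Set (Euc d)) : Prop :=
  ∀ e e' : Set (Euc d), IsEdgeSet P e → IsEdgeSet P e' →
    ∃ T : Euc d ≃ₗᵢ[ℝ] Euc d, IsAut P T ∧ T '' e = e'

/-- `P` is bipartite with vertex partition `V1, V2`, radii `r1 ≤ r2` and edge length `ℓ`:
all edges have length `ℓ`, every edge joins `V1` to `V2`, where `V1 ⊔ V2` is a partition of
the vertex set, and vertices in `Vᵢ` have norm `rᵢ`. -/
def IsBipartiteWith {d : ℕ} (P V1 V2 : Set (Euc d)) (r1 r2 ℓ : ℝ) : Prop :=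
  (0 < ℓ) ∧ (∀ v w : Euc d, IsEdge P v w → ‖v - w‖ = ℓ) ∧
  (V1 ∪ V2 = Set.extremePoints ℝ P) ∧ Disjoint V1 V2 ∧
  (∀ v w : Euc d, IsEdge P v w → (v ∈ V1 ∧ w ∈ V2) ∨ (v ∈ V2 ∧ w ∈ V1)) ∧
  (0 < r1) ∧ (r1 ≤ r2) ∧ (∀ v ∈ V1, ‖v‖ = r1) ∧ (∀ v ∈ V2, ‖v‖ = r2)

/-- `P` is a bipartite polytope. -/
def IsBipartite {d : ℕ} (P : Set (Euc d)) : Prop :=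
  ∃ (V1 V2 : Set (Euc d)) (r1 r2 ℓ : ℝ), IsBipartiteWith P V1 V2 r1 r2 ℓ

/-- `P` is a strictly bipartite polytope (`r1 < r2`). -/
def IsStrictlyBipartite {d : ℕ} (P : Set (Euc d)) : Prop :=
  ∃ (V1 V2 : Set (Euc d)) (r1 r2 ℓ : ℝ), IsBipartiteWith P V1 V2 r1 r2 ℓ ∧ r1 < r2

/-- A reflection of `ℝ^d`: a non-identity involutive linear isometry whose fixed-point
subspace has dimension `d - 1`. -/
def IsLinearReflection {d : ℕ} (R : Euc d ≃ₗᵢ[ℝ] Euc d) : Prop :=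
  R ≠ 1 ∧ R * R = 1 ∧
  Module.finrank ℝ
    (LinearMap.ker ((R.toLinearEquiv : Euc d →ₗ[ℝ] Euc d) - LinearMap.id)) = d - 1

/-- A finite reflection group: a finite subgroup of the linear isometry group that is
generated by the reflections it contains. -/
def IsFiniteReflectionGroup {d : ℕ} (Γ : Subgroup (Euc d ≃ₗᵢ[ℝ] Euc d)) : Prop :=
  (Γ : Set (Euc d ≃ₗᵢ[ℝ] Euc d)).Finite ∧
  Γ = Subgroup.closure {R | IsLinearReflection R ∧ R ∈ Γ}

/-- `v` is generic for `Γ`: no non-identity element of `Γ` fixes `v`. -/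
def IsGenericFor {d : ℕ} (Γ : Subgroup (Euc d ≃ₗᵢ[ℝ] Euc d)) (v : Euc d) : Prop :=
  ∀ T ∈ Γ, T ≠ 1 → T v ≠ v

/-- `P` is the `Γ`-permutahedron with generic point `v`: the convex hull of the orbit of
`v` under `Γ`. -/
def IsPermutahedron {d : ℕ} (P : Set (Euc d)) : Prop :=
  ∃ (Γ : Subgroup (Euc d ≃ₗᵢ[ℝ] Euc d)) (v : Euc d),
    IsFiniteReflectionGroup Γ ∧ IsGenericFor Γ v ∧
    P = convexHull ℝ {x | ∃ T ∈ Γ, x = T v}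

open Filter Topology RealInnerProductSpace

section Faces

variable {E : Type*} [NormedAddCommGroup E] [InnerProductSpace ℝ E]

/-- `x` is orthogonal to no element of `A`. -/
def Avoids (A : Set E) (x : E) : Prop := ∀ a ∈ A, ⟪a, x⟫ ≠ 0

theorem dense_inner_ne_zero {a : E} (ha : a ≠ 0) : Dense {x : E | ⟪a, x⟫ ≠ 0} := by
  rw [dense_iff_inter_open]
  intro U hU ⟨x, hx⟩
  by_contra hne
  have h0 : ∀ y ∈ U, ⟪a, y⟫ = 0 := fun y hy => by
    by_contra h
    exact hne ⟨y, hy, h⟩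
  have hcont : Tendsto (fun t : ℝ => x + t • a) (𝓝 0) (𝓝 x) := by
    have : Continuous (fun t : ℝ => x + t • a) := by fun_prop
    simpa using this.tendsto 0
  have hev : ∀ᶠ t in 𝓝[≠] (0 : ℝ), x + t • a ∈ U :=
    (hcont.eventually (hU.mem_nhds hx)).filter_mono nhdsWithin_le_nhds
  obtain ⟨t, ht, ht0⟩ := (hev.and self_mem_nhdsWithin).exists
  have h1 := h0 _ ht
  rw [inner_add_right, h0 x hx, inner_smul_right, zero_add] at h1
  rcases mul_eq_zero.1 h1 with h | h
  · exact ht0 h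
  · exact ha (inner_self_eq_zero.1 h)

theorem isOpen_avoids {A : Set E} (hA : A.Finite) : IsOpen {x | Avoids A x} := by
  have : {x | Avoids A x} = ⋂ a ∈ A, {x : E | ⟪a, x⟫ ≠ 0} := by
    ext x; simp [Avoids]
  rw [this]
  exact hA.isOpen_biInter fun a _ => isOpen_ne_fun (by fun_prop) (by fun_prop)

theorem dense_avoids {A : Set E} (hA : A.Finite) (h0 : (0 : E) ∉ A) :
    Dense {x | Avoids A x} := by
  induction A, hA using Set.Finite.induction_on with
  | empty => simp [Avoids]
  | @insert a s _ hs ih =>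
    have h : {x | Avoids (insert a s) x} = {x : E | ⟪a, x⟫ ≠ 0} ∩ {x | Avoids s x} := by
      ext x; simp [Avoids]
    rw [h]
    refine (dense_inner_ne_zero ?_).inter_of_isOpen_right (ih ?_) (isOpen_avoids hs)
    · rintro rfl; exact h0 (mem_insert _ _)
    · exact fun h => h0 (mem_insert_of_mem _ h)

theorem exists_avoids_of_eventually {A : Set E} (hA : A.Finite) (h0 : (0 : E) ∉ A) {x : E}
    {p : E → Prop} (hp : ∀ᶠ y in 𝓝 x, p y) : ∃ y, p y ∧ Avoids A y := by
  obtain ⟨y, hy, hy'⟩ := (dense_avoids hA h0).inter_nhds_nonempty hp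
  exact ⟨y, hy', hy⟩

/-- A predicate on the complement of a finite hyperplane arrangement which is locally constant
off the intersections of two distinct hyperplanes is constant. -/
theorem avoids_induction {A : Set E} (hA : A.Finite) (h0 : (0 : E) ∉ A) (S : E → Prop)
    (hloc : ∀ x, (∀ a ∈ A, ∀ b ∈ A, ⟪a, x⟫ = 0 → ⟪b, x⟫ = 0 → ∃ t : ℝ, b = t • a) →
      (∀ᶠ y in 𝓝 x, Avoids A y → S y) ∨ (∀ᶠ y in 𝓝 x, Avoids A y → ¬ S y))
    {x : E} (hx : Avoids A x) (hSx : S x) {y : E} (hy : Avoids A y) : S y := by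
  have hvac : ∀ z, Avoids A z →
      (∀ a ∈ A, ∀ b ∈ A, ⟪a, z⟫ = 0 → ⟪b, z⟫ = 0 → ∃ t : ℝ, b = t • a) :=
    fun z hz a ha b _ h => absurd h (hz a ha)
  rcases hloc y (hvac y hy) with h | h
  · exact h.self_of_nhds hy
  exfalso
  set B : Set E := (image2 (fun a b => ⟪a, x⟫ • b - ⟪b, x⟫ • a) A A) \ {0} with hB
  have hBfin : B.Finite := (hA.image2 _ hA).subset sdiff_subset
  have hyA : ∀ᶠ z in 𝓝 y, Avoids A z := (isOpen_avoids hA).mem_nhds hy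
  obtain ⟨z, ⟨hz1, hzA⟩, hzB⟩ :=
    exists_avoids_of_eventually hBfin (by simp [hB]) (h.eventually_nhds.and hyA)
  have hU1 : IsOpen {w | ∀ᶠ u in 𝓝 w, Avoids A u → S u} := isOpen_setOfPred_eventually_nhds
  have hU2 : IsOpen {w | ∀ᶠ u in 𝓝 w, Avoids A u → ¬ S u} := isOpen_setOfPred_eventually_nhds
  have hcov : segment ℝ x z ⊆
      {w | ∀ᶠ u in 𝓝 w, Avoids A u → S u} ∪ {w | ∀ᶠ u in 𝓝 w, Avoids A u → ¬ S u} := by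
    rintro w ⟨s, t, hs, ht, hst, rfl⟩
    apply hloc
    intro a ha b hb h1 h2
    simp only [inner_add_right, inner_smul_right] at h1 h2
    have hax := hx a ha
    have ht0 : t ≠ 0 := by
      rintro rfl
      have : s = 1 := by linarith
      subst this
      simp at h1
      exact hax h1
    have key : ⟪⟪a, x⟫ • b - ⟪b, x⟫ • a, z⟫ = 0 := by
      rw [inner_sub_left, inner_smul_left, inner_smul_left]
      simp only [conj_trivial]
      apply mul_left_cancel₀ ht0
      linear_combination ⟪a, x⟫ * h2 - ⟪b, x⟫ * h1
    have hzero : ⟪a, x⟫ • b - ⟪b, x⟫ • a = 0 := by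
      by_contra hne
      exact hzB _ ⟨mem_image2_of_mem ha hb, hne⟩ key
    refine ⟨⟪a, x⟫⁻¹ * ⟪b, x⟫, ?_⟩
    rw [mul_smul, ← sub_eq_zero.1 hzero, smul_smul, inv_mul_cancel₀ hax, one_smul]
  have hx1 : ∀ᶠ u in 𝓝 x, Avoids A u → S u := by
    rcases hloc x (hvac x hx) with h | h
    · exact h
    · exact absurd hSx (h.self_of_nhds hx)
  obtain ⟨w, -, hw1, hw2⟩ := (convex_segment x z).isPreconnected _ _ hU1 hU2 hcov
    ⟨x, left_mem_segment ℝ x z, hx1⟩ ⟨z, right_mem_segment ℝ x z, hz1⟩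
  obtain ⟨u, ⟨hu1, hu2⟩, hu⟩ := exists_avoids_of_eventually hA h0 (hw1.and hw2)
  exact hu2 hu (hu1 hu)

/-- The points of `V` at which `⟪c, ·⟫` is maximal. -/
def face (V : Set E) (c : E) : Set E := {v | v ∈ V ∧ ∀ w ∈ V, ⟪c, w⟫ ≤ ⟪c, v⟫}

/-- `v` and `w` are the two ends of an edge of the convex hull of `V`, for `V` in convex
position. -/
def Adj (V : Set E) (v w : E) : Prop := v ≠ w ∧ ∃ c, face V c = {v, w}

theorem face_subset (V : Set E) (c : E) : face V c ⊆ V := fun _ h => h.1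

theorem face_nonempty {V : Set E} (hV : V.Finite) (hne : V.Nonempty) (c : E) :
    (face V c).Nonempty := by
  obtain ⟨v, hv, h⟩ := hV.exists_maximalFor (fun v => ⟪c, v⟫) V hne
  refine ⟨v, hv, fun w hw => ?_⟩
  by_contra hlt
  push Not at hlt
  exact absurd (h hw hlt.le) (not_le.2 hlt)

theorem inner_eq_of_mem_face {V : Set E} {c v w : E} (hv : v ∈ face V c) (hw : w ∈ face V c) :
    ⟪c, v⟫ = ⟪c, w⟫ :=
  le_antisymm (hw.2 v hv.1) (hv.2 w hw.1)

theorem inner_sub_eq_zero_of_mem_face {V : Set E} {c v w : E} (hv : v ∈ face V c)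
    (hw : w ∈ face V c) : ⟪v - w, c⟫ = 0 := by
  rw [real_inner_comm, inner_sub_right, inner_eq_of_mem_face hv hw, sub_self]

theorem inner_lt_of_notMem_face {V : Set E} {c v w : E} (hv : v ∈ face V c) (hw : w ∈ V)
    (hwf : w ∉ face V c) : ⟪c, w⟫ < ⟪c, v⟫ := by
  refine lt_of_le_of_ne (hv.2 w hw) fun h => hwf ⟨hw, fun u hu => ?_⟩
  rw [h]; exact hv.2 u hu

theorem eventually_face_eq {V : Set E} (hV : V.Finite) (c : E) :
    ∀ᶠ c' in 𝓝 c, face V c' = face (face V c) c' := by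
  rcases V.eq_empty_or_nonempty with rfl | hne
  · exact Eventually.of_forall fun c' => by ext; simp [face]
  obtain ⟨m, hm⟩ := face_nonempty hV hne c
  have h : ∀ᶠ c' in 𝓝 c, ∀ w ∈ V \ face V c, ⟪c', w⟫ < ⟪c', m⟫ := by
    rw [Filter.eventually_all_finite (hV.subset sdiff_subset)]
    intro w hw
    have := inner_lt_of_notMem_face hm hw.1 hw.2
    exact (isOpen_lt (f := fun c' : E => ⟪c', w⟫) (g := fun c' : E => ⟪c', m⟫)
      (by fun_prop) (by fun_prop)).mem_nhds this
  filter_upwards [h] with c' hc'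
  ext v
  constructor
  · rintro ⟨hv, hmax⟩
    have hvf : v ∈ face V c := by
      by_contra hvf
      exact absurd (hmax m hm.1) (not_le.2 (hc' v ⟨hv, hvf⟩))
    exact ⟨hvf, fun w hw => hmax w hw.1⟩
  · rintro ⟨hv, hmax⟩
    refine ⟨hv.1, fun w hw => ?_⟩
    by_cases hwf : w ∈ face V c
    · exact hmax w hwf
    · exact (hc' w ⟨hw, hwf⟩).le.trans (hmax m hm)

theorem eventually_face_subset {V : Set E} (hV : V.Finite) (c : E) :
    ∀ᶠ c' in 𝓝 c, face V c' ⊆ face V c :=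
  (eventually_face_eq hV c).mono fun _ h => h ▸ face_subset _ _

theorem Adj.symm {V : Set E} {v w : E} (h : Adj V v w) : Adj V w v :=
  ⟨h.1.symm, h.2.imp fun c hc => by rw [hc, pair_comm]⟩

theorem Adj.left_mem {V : Set E} {v w : E} (h : Adj V v w) : v ∈ V := by
  obtain ⟨_, c, hc⟩ := h
  exact face_subset V c (hc ▸ mem_insert _ _)

theorem Adj.right_mem {V : Set E} {v w : E} (h : Adj V v w) : w ∈ V := h.symm.left_mem

/-- Edges of a face are edges. -/
theorem Adj.of_face {V : Set E} (hV : V.Finite) {x v w : E} (h : Adj (face V x) v w) :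
    Adj V v w := by
  obtain ⟨hne, c, hc⟩ := h
  refine ⟨hne, ?_⟩
  have hcont : Tendsto (fun t : ℝ => x + t • c) (𝓝 0) (𝓝 x) := by
    have : Continuous (fun t : ℝ => x + t • c) := by fun_prop
    simpa using this.tendsto 0
  have hev := (hcont.eventually (eventually_face_eq hV x)).filter_mono
    (nhdsWithin_le_nhds (s := Ioi 0))
  obtain ⟨t, ht, ht0⟩ := (hev.and self_mem_nhdsWithin).exists
  refine ⟨x + t • c, ht.trans ?_⟩
  rw [← hc]
  ext v
  refine and_congr_right fun hv => forall₂_congr fun w hw => ?_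
  rw [inner_add_left, inner_add_left, inner_smul_left, inner_smul_left,
    inner_eq_of_mem_face hv hw]
  simp only [conj_trivial, add_le_add_iff_left]
  exact mul_le_mul_iff_right₀ ht0

theorem face_image (T : E ≃ₗᵢ[ℝ] E) {V : Set E} (hT : ∀ v, T v ∈ V ↔ v ∈ V) (c v : E) :
    T v ∈ face V (T c) ↔ v ∈ face V c := by
  refine and_congr (hT v) ⟨fun h w hw => ?_, fun h w hw => ?_⟩
  · simpa using h (T w) ((hT w).2 hw)
  · have := h (T.symm w) ((hT _).1 (by simpa using hw))
    rwa [← T.inner_map_map, ← T.inner_map_map c v, T.apply_symm_apply] at this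

theorem Adj.map {V : Set E} {v w : E} (h : Adj V v w) (T : E ≃ₗᵢ[ℝ] E)
    (hT : ∀ v, T v ∈ V ↔ v ∈ V) : Adj V (T v) (T w) := by
  obtain ⟨hne, c, hc⟩ := h
  refine ⟨fun h => hne (T.injective h), T c, ?_⟩
  ext x
  obtain ⟨x, rfl⟩ := T.surjective x
  rw [face_image T hT, hc]
  simp

/-- A line meets a sphere in at most two points. -/
theorem eq_or_eq_of_norm_eq {x y z : E} {r t : ℝ} (hx : ‖x‖ = r) (hy : ‖y‖ = r) (hz : ‖z‖ = r)
    (hxy : x ≠ y) (h : z - x = t • (y - x)) : z = x ∨ z = y := by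
  have hz' : z = x + t • (y - x) := by rw [← h]; abel
  have hy' : y = x + (y - x) := by abel
  have e1 := norm_add_sq_real x (y - x)
  have e2 := norm_add_sq_real x (t • (y - x))
  rw [← hy', hx, hy] at e1
  rw [← hz', hx, hz, inner_smul_right, norm_smul, mul_pow, Real.norm_eq_abs, sq_abs] at e2
  have hpos : ‖y - x‖ ^ 2 ≠ 0 := by
    have : y - x ≠ 0 := sub_ne_zero.2 hxy.symm
    positivity
  have : t * (t - 1) = 0 := by
    apply mul_right_cancel₀ hpos
    linear_combination t * e1 - e2
  rcases mul_eq_zero.1 this with ht | ht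
  · left; rw [hz', ht]; simp
  · right; rw [hz', sub_eq_zero.1 ht]; simp

theorem eq_of_inner_ge {x y : E} {r : ℝ} (hx : ‖x‖ = r) (hy : ‖y‖ = r)
    (h : ⟪x, x⟫ ≤ ⟪x, y⟫) : y = x := by
  rw [← sub_eq_zero, ← norm_eq_zero, ← sq_eq_zero_iff, norm_sub_sq_real, real_inner_comm, hx, hy]
  rw [real_inner_self_eq_norm_sq, hx] at h
  have := real_inner_le_norm x y
  rw [hx, hy] at this
  nlinarith

theorem face_self {V : Set E} {r : ℝ} (hV : ∀ v ∈ V, ‖v‖ = r) {v : E} (hv : v ∈ V) :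
    face V v = {v} := by
  ext w
  constructor
  · rintro ⟨hw, h⟩
    exact eq_of_inner_ge (hV v hv) (hV w hw) (h v hv)
  · rintro rfl
    refine ⟨hv, fun u hu => ?_⟩
    have := real_inner_le_norm w u
    rwa [hV w hv, hV u hu, ← hV w hv, ← sq, ← real_inner_self_eq_norm_sq] at this

/-- A finite set on a sphere around the origin such that the edges of its convex hull have a
common length and have exactly one endpoint in `col`. -/
structure InscribedBipartite (V : Set E) (r ℓ : ℝ) (col : Set E) : Prop where
  finite : V.Finite
  norm_eq : ∀ v ∈ V, ‖v‖ = r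
  norm_sub_eq : ∀ v w, Adj V v w → ‖v - w‖ = ℓ
  mem_iff : ∀ v w, Adj V v w → (v ∈ col ↔ w ∉ col)

theorem InscribedBipartite.restrict_face {V : Set E} {r ℓ : ℝ} {col : Set E}
    (h : InscribedBipartite V r ℓ col) (c : E) : InscribedBipartite (face V c) r ℓ col where
  finite := h.finite.subset (face_subset V c)
  norm_eq v hv := h.norm_eq v hv.1
  norm_sub_eq v w hvw := h.norm_sub_eq v w (hvw.of_face h.finite)
  mem_iff v w hvw := h.mem_iff v w (hvw.of_face h.finite)

end Faces

section Plane

open ComplexConjugate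

variable {W : Set ℂ} {r ℓ : ℝ} {col : Set ℂ}

/-- The slope of the chord from `z` to `w`, where `z` and `w` lie on a circle around the origin,
with respect to the tangent at `z`, up to a positive factor. -/
def chordSlope (z w : ℂ) : ℝ := (w / z).im / (1 - (w / z).re)

theorem div_re_lt_one {z w : ℂ} (hr : 0 < r) (hz : ‖z‖ = r) (hw : ‖w‖ = r) (h : w ≠ z) :
    (w / z).re < 1 := by
  have hz0 : z ≠ 0 := by rw [← norm_pos_iff, hz]; exact hr
  have hn : ‖w / z‖ = 1 := by rw [norm_div, hz, hw, div_self hr.ne']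
  refine lt_of_le_of_ne (hn ▸ Complex.re_le_norm _) fun h1 => h ?_
  have h2 := Complex.sq_norm (w / z)
  rw [hn, Complex.normSq_apply, h1] at h2
  have h3 : (w / z).im = 0 := by nlinarith
  have : w / z = 1 := Complex.ext h1 h3
  rwa [div_eq_one_iff_eq hz0] at this

theorem eq_of_chordSlope_eq {z w w' : ℂ} (hr : 0 < r) (hz : ‖z‖ = r) (hw : ‖w‖ = r)
    (hw' : ‖w'‖ = r) (h : w ≠ z) (h' : w' ≠ z) (hs : chordSlope z w = chordSlope z w') :
    w = w' := by
  have hz0 : z ≠ 0 := by rw [← norm_pos_iff, hz]; exact hr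
  have h1 := div_re_lt_one hr hz hw h
  have h1' := div_re_lt_one hr hz hw' h'
  have h2 := Complex.sq_norm (w / z)
  have h2' := Complex.sq_norm (w' / z)
  rw [norm_div, hz, hw, div_self hr.ne', Complex.normSq_apply] at h2
  rw [norm_div, hz, hw', div_self hr.ne', Complex.normSq_apply] at h2'
  have hz1 : (1 - (w / z).re) ≠ 0 := by linarith
  have hz1' : (1 - (w' / z).re) ≠ 0 := by linarith
  have e : (w / z).im = chordSlope z w * (1 - (w / z).re) := by
    rw [chordSlope, div_mul_cancel₀ _ hz1]
  have e' : (w' / z).im = chordSlope z w * (1 - (w' / z).re) := by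
    rw [hs, chordSlope, div_mul_cancel₀ _ hz1']
  set t := chordSlope z w
  have f : t ^ 2 * (1 - (w / z).re) = 1 + (w / z).re := by
    apply mul_right_cancel₀ hz1
    rw [e] at h2
    linear_combination -h2
  have f' : t ^ 2 * (1 - (w' / z).re) = 1 + (w' / z).re := by
    apply mul_right_cancel₀ hz1'
    rw [e'] at h2'
    linear_combination -h2'
  have hre : (w / z).re = (w' / z).re := by
    have : (t ^ 2 + 1) * ((w / z).re - (w' / z).re) = 0 := by linear_combination f' - f
    have h3 : t ^ 2 + 1 ≠ 0 := by positivity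
    linarith [(mul_eq_zero.1 this).resolve_left h3]
  have him : (w / z).im = (w' / z).im := by rw [e, e', hre]
  exact (div_left_inj' hz0).1 (Complex.ext hre him)

theorem inner_chord {z w : ℂ} (hr : 0 < r) (hz : ‖z‖ = r) (hw : ‖w‖ = r) (h : w ≠ z) (t : ℝ) :
    ⟪t • z + Complex.I * z, w - z⟫ = r ^ 2 * (1 - (w / z).re) * (chordSlope z w - t) := by
  have hz0 : z ≠ 0 := by rw [← norm_pos_iff, hz]; exact hr
  have hz1 : (1 - (w / z).re) ≠ 0 := by linarith [div_re_lt_one hr hz hw h]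
  have e : (w / z).im = chordSlope z w * (1 - (w / z).re) := by
    rw [chordSlope, div_mul_cancel₀ _ hz1]
  have e2 : r ^ 2 = z.re * z.re + z.im * z.im := by
    rw [← hz, Complex.sq_norm, Complex.normSq_apply]
  have hsw : w = (w / z) * z := by field_simp
  have : r ^ 2 * (1 - (w / z).re) * (chordSlope z w - t)
      = r ^ 2 * ((w / z).im - t * (1 - (w / z).re)) := by rw [e]; ring
  rw [this]
  generalize w / z = s at hsw
  subst hsw
  rw [e2, Complex.inner]
  simp
  ring

theorem adj_of_chordSlope {ε : ℝ} (hε : ε ≠ 0) (hr : 0 < r) (hW : ∀ w ∈ W, ‖w‖ = r) {z a : ℂ}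
    (hz : z ∈ W) (ha : a ∈ W) (haz : a ≠ z)
    (hmax : ∀ w ∈ W, w ≠ z → ε * chordSlope z w ≤ ε * chordSlope z a) : Adj W z a := by
  refine ⟨haz.symm, ε • (chordSlope z a • z + Complex.I * z), ?_⟩
  have key : ∀ w ∈ W, w ≠ z →
      ⟪ε • (chordSlope z a • z + Complex.I * z), w - z⟫
        = r ^ 2 * (1 - (w / z).re) * (ε * chordSlope z w - ε * chordSlope z a) := by
    intro w hw hwz
    rw [inner_smul_left, inner_chord hr (hW z hz) (hW w hw) hwz]
    simp only [conj_trivial]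
    ring
  set c := ε • (chordSlope z a • z + Complex.I * z)
  have hpos : ∀ w ∈ W, w ≠ z → 0 < r ^ 2 * (1 - (w / z).re) := fun w hw hwz =>
    mul_pos (by positivity) (by linarith [div_re_lt_one hr (hW z hz) (hW w hw) hwz])
  have hle : ∀ w ∈ W, ⟪c, w⟫ ≤ ⟪c, z⟫ := by
    intro w hw
    by_cases hwz : w = z
    · rw [hwz]
    · have := key w hw hwz
      rw [inner_sub_right] at this
      nlinarith [hpos w hw hwz, hmax w hw hwz]
  have hac : ⟪c, a⟫ = ⟪c, z⟫ := by
    have := key a ha haz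
    rw [inner_sub_right, sub_self, mul_zero] at this
    linarith
  ext w
  constructor
  · rintro ⟨hw, h⟩
    by_cases hwz : w = z
    · exact Or.inl hwz
    · right
      have h0 := key w hw hwz
      rw [inner_sub_right, le_antisymm (hle w hw) (h z hz), sub_self, eq_comm, mul_eq_zero] at h0
      have h1 := h0.resolve_left (hpos w hw hwz).ne'
      rw [← mul_sub] at h1
      exact eq_of_chordSlope_eq hr (hW z hz) (hW w hw) (hW a ha) hwz haz
        (sub_eq_zero.1 ((mul_eq_zero.1 h1).resolve_left hε))
  · rintro (rfl | rfl)
    · exact ⟨hz, hle⟩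
    · exact ⟨ha, fun w hw => hac ▸ hle w hw⟩

/-- Every vertex of an inscribed polygon lies on two edges. -/
theorem exists_two_adj (hfin : W.Finite) (hr : 0 < r) (hW : ∀ w ∈ W, ‖w‖ = r)
    (h3 : ∀ p q, ¬ W ⊆ {p, q}) {z : ℂ} (hz : z ∈ W) :
    ∃ a b, a ≠ b ∧ Adj W z a ∧ Adj W z b := by
  have hfin' : (W \ {z}).Finite := hfin.subset sdiff_subset
  have hne : (W \ {z}).Nonempty := by
    rw [nonempty_iff_ne_empty, Ne, sdiff_eq_empty]
    exact fun h => h3 z z (by simpa using h)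
  have hex : ∀ ε : ℝ, ∃ a ∈ W, a ≠ z ∧
      ∀ w ∈ W, w ≠ z → ε * chordSlope z w ≤ ε * chordSlope z a := by
    intro ε
    obtain ⟨a, ha, h⟩ := hfin'.exists_maximalFor (fun w => ε * chordSlope z w) _ hne
    refine ⟨a, ha.1, ha.2, fun w hw hwz => ?_⟩
    by_contra hlt
    push Not at hlt
    exact absurd (h ⟨hw, hwz⟩ hlt.le) (not_le.2 hlt)
  obtain ⟨a, ha, haz, hamax⟩ := hex 1
  obtain ⟨b, hb, hbz, hbmax⟩ := hex (-1)
  refine ⟨a, b, ?_, adj_of_chordSlope one_ne_zero hr hW hz ha haz hamax,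
    adj_of_chordSlope (by norm_num) hr hW hz hb hbz hbmax⟩
  rintro rfl
  refine h3 z a fun w hw => ?_
  by_cases hwz : w = z
  · exact Or.inl hwz
  · have h1 := hamax w hw hwz
    have h2 := hbmax w hw hwz
    exact Or.inr (eq_of_chordSlope_eq hr (hW z hz) (hW w hw) (hW a ha) hwz haz (by linarith))

theorem eq_or_eq_conj {s t : ℂ} (hs : ‖s‖ = 1) (ht : ‖t‖ = 1) (h : ‖s - 1‖ = ‖t - 1‖) :
    t = s ∨ t = conj s := by
  have e1 := Complex.sq_norm s
  have e2 := Complex.sq_norm t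
  have e3 := Complex.sq_norm (s - 1)
  have e4 := Complex.sq_norm (t - 1)
  rw [hs, Complex.normSq_apply] at e1
  rw [ht, Complex.normSq_apply] at e2
  rw [h, e4, Complex.normSq_apply, Complex.normSq_apply] at e3
  simp at e3
  have hre : t.re = s.re := by nlinarith
  have him : (t.im - s.im) * (t.im + s.im) = 0 := by rw [hre] at e2; nlinarith
  rcases mul_eq_zero.1 him with h | h
  · left; exact Complex.ext hre (by linarith)
  · right; exact Complex.ext (by simpa using hre) (by simp; linarith)

/-- An inscribed bipartite polygon is invariant under a rotation that maps vertices to adjacent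
vertices. -/
theorem exists_rotation (H : InscribedBipartite W r ℓ col) (h3 : ∀ p q, ¬ W ⊆ {p, q}) :
    ∃ ζ : ℂ, ‖ζ‖ = 1 ∧ ζ.im ≠ 0 ∧ (∀ z ∈ W, Adj W z (ζ * z)) ∧ (∀ z ∈ W, Adj W z (conj ζ * z)) ∧
      ∀ z a, z ∈ W → a ∈ W → ‖z - a‖ = ℓ → a = ζ * z ∨ a = conj ζ * z := by
  have hr : 0 < r := by
    by_contra hr
    refine h3 0 0 fun w hw => ?_
    have := H.norm_eq w hw
    left
    rw [← norm_eq_zero]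
    linarith [norm_nonneg w]
  have hne : W.Nonempty := by
    rw [nonempty_iff_ne_empty]
    rintro rfl
    exact h3 0 0 (empty_subset _)
  obtain ⟨z₀, hz₀⟩ := hne
  obtain ⟨a₀, -, -, h₀, -⟩ := exists_two_adj H.finite hr H.norm_eq h3 hz₀
  have hW0 : ∀ z ∈ W, z ≠ 0 := fun z hz => by rw [← norm_pos_iff, H.norm_eq z hz]; exact hr
  have hnorm : ∀ z ∈ W, ∀ a ∈ W, ‖a / z‖ = 1 := fun z hz a ha => by
    rw [norm_div, H.norm_eq z hz, H.norm_eq a ha, div_self hr.ne']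
  have hdist : ∀ z ∈ W, ∀ a, ‖z - a‖ = ℓ → ‖a / z - 1‖ = ℓ / r := fun z hz a h => by
    rw [div_sub_one (hW0 z hz), norm_div, H.norm_eq z hz, norm_sub_rev, h]
  have hall : ∀ z a, z ∈ W → a ∈ W → ‖z - a‖ = ℓ →
      a = (a₀ / z₀) * z ∨ a = conj (a₀ / z₀) * z := fun z a hz ha h => by
    have := eq_or_eq_conj (hnorm z₀ hz₀ a₀ h₀.right_mem) (hnorm z hz a ha)
      ((hdist z₀ hz₀ a₀ (H.norm_sub_eq _ _ h₀)).trans (hdist z hz a h).symm)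
    rwa [div_eq_iff (hW0 z hz), div_eq_iff (hW0 z hz)] at this
  have hζ := hnorm z₀ hz₀ a₀ h₀.right_mem
  generalize a₀ / z₀ = ζ at hall hζ
  have hboth : ∀ z ∈ W, ζ * z ≠ conj ζ * z ∧ Adj W z (ζ * z) ∧ Adj W z (conj ζ * z) := by
    intro z hz
    obtain ⟨a, b, hab, ha, hb⟩ := exists_two_adj H.finite hr H.norm_eq h3 hz
    rcases hall z a hz ha.right_mem (H.norm_sub_eq _ _ ha) with rfl | rfl <;>
    rcases hall z b hz hb.right_mem (H.norm_sub_eq _ _ hb) with rfl | rfl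
    · exact absurd rfl hab
    · exact ⟨hab, ha, hb⟩
    · exact ⟨hab.symm, hb, ha⟩
    · exact absurd rfl hab
  refine ⟨ζ, hζ, fun him => (hboth z₀ hz₀).1 ?_, fun z hz => (hboth z hz).2.1,
    fun z hz => (hboth z hz).2.2, hall⟩
  rw [Complex.conj_eq_iff_im.2 him]

section Rotation

variable {ζ : ℂ}

theorem pow_mul_mem (hadj : ∀ z ∈ W, Adj W z (ζ * z)) {z : ℂ} (hz : z ∈ W) (k : ℕ) :
    ζ ^ k * z ∈ W := by
  induction k with
  | zero => simpa
  | succ k ih => rw [pow_succ', mul_assoc]; exact (hadj _ ih).right_mem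

theorem exists_pow_eq_one (hfin : W.Finite) (hadj : ∀ z ∈ W, Adj W z (ζ * z)) {z : ℂ}
    (hz : z ∈ W) (hz0 : z ≠ 0) : IsOfFinOrder ζ := by
  have hninj : ¬ Function.Injective fun k : ℕ => ζ ^ k * z := fun hinj =>
    Set.infinite_range_of_injective hinj
      (hfin.subset (range_subset_iff.2 fun k => pow_mul_mem hadj hz k))
  have hζ0 : ζ ≠ 0 := by
    rintro rfl
    have h := hadj _ (hadj z hz).right_mem
    simp at h
    exact h.1 rfl
  have key : ∀ m n : ℕ, m < n → ζ ^ m * z = ζ ^ n * z → IsOfFinOrder ζ := by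
    intro m n hmn h
    refine isOfFinOrder_iff_pow_eq_one.2 ⟨n - m, by omega, ?_⟩
    apply mul_left_cancel₀ (pow_ne_zero m hζ0)
    rw [← pow_add, Nat.add_sub_cancel' hmn.le, mul_one, mul_right_cancel₀ hz0 h]
  simp only [Function.Injective, not_forall] at hninj
  obtain ⟨m, n, h, hmn⟩ := hninj
  rcases lt_or_gt_of_ne hmn with hlt | hlt
  · exact key m n hlt h
  · exact key n m hlt h.symm

theorem neg_mem_of_rotation (H : InscribedBipartite W r ℓ col)
    (hadj : ∀ z ∈ W, Adj W z (ζ * z)) {z : ℂ} (hz : z ∈ W) (hz0 : z ≠ 0) : -z ∈ W := by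
  have hord := exists_pow_eq_one H.finite hadj hz hz0
  have hcol : ∀ k, (ζ ^ k * z ∈ col ↔ (Even k ↔ z ∈ col)) := by
    intro k
    induction k with
    | zero => simp
    | succ k ih =>
      have := H.mem_iff _ _ (hadj _ (pow_mul_mem hadj hz k))
      rw [← mul_assoc, ← pow_succ'] at this
      rw [Nat.even_add_one]
      tauto
  have heven : Even (orderOf ζ) := by
    have := hcol (orderOf ζ)
    rw [pow_orderOf_eq_one, one_mul] at this
    tauto
  obtain ⟨m, hm⟩ := heven
  have hpos := hord.orderOf_pos
  have hsq : ζ ^ m * ζ ^ m = 1 := by rw [← pow_add, ← hm, pow_orderOf_eq_one]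
  have hne : ζ ^ m ≠ 1 := fun h => by
    have := orderOf_le_of_pow_eq_one (by omega) h
    omega
  have := pow_mul_mem hadj hz m
  rwa [(mul_self_eq_one_iff.1 hsq).resolve_left hne, neg_one_mul] at this

theorem exists_real_combination (hζ : ‖ζ‖ = 1) (him : ζ.im ≠ 0) (t : ℂ) :
    ∃ α β : ℝ, t = α * (ζ - 1) + β * (conj ζ - 1) := by
  have hre : ζ.re - 1 ≠ 0 := by
    intro h
    have := Complex.sq_norm ζ
    rw [hζ, Complex.normSq_apply, sub_eq_zero.1 h] at this
    have : ζ.im * ζ.im = 0 := by linarith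
    exact him (mul_self_eq_zero.1 this)
  refine ⟨(t.re / (ζ.re - 1) + t.im / ζ.im) / 2, (t.re / (ζ.re - 1) - t.im / ζ.im) / 2, ?_⟩
  have h1 : t.re / (ζ.re - 1) * (ζ.re - 1) = t.re := div_mul_cancel₀ _ hre
  have h2 : t.im / ζ.im * ζ.im = t.im := div_mul_cancel₀ _ him
  generalize t.re / (ζ.re - 1) = x at *
  generalize t.im / ζ.im = y at *
  apply Complex.ext
  · rw [← h1]; simp; ring
  · rw [← h2]; simp; ring

theorem coeff_nonneg {z a b w : ℂ} {α β : ℝ} (ha : Adj W z a)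
    (hunique : ∀ c, face W c = {z, a} → b ∉ face W c) (hb : b ∈ W) (hw : w ∈ W)
    (h : w - z = α • (a - z) + β • (b - z)) : 0 ≤ β := by
  obtain ⟨-, c, hc⟩ := ha
  have hz : z ∈ face W c := hc ▸ mem_insert _ _
  have haf : a ∈ face W c := hc ▸ mem_insert_of_mem _ rfl
  have h1 := inner_lt_of_notMem_face hz hb (hunique c hc)
  have h2 := hz.2 w hw
  have h3 := congrArg (fun x => ⟪c, x⟫) h
  simp only [inner_add_right, inner_smul_right, inner_sub_right,
    inner_eq_of_mem_face hz haf] at h3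
  rw [inner_eq_of_mem_face hz haf] at h1 h2
  nlinarith

theorem mem_orbit_of_rotation (H : InscribedBipartite W r ℓ col) (hζ : ‖ζ‖ = 1)
    (him : ζ.im ≠ 0) (hadj : ∀ z ∈ W, Adj W z (ζ * z)) (hadj' : ∀ z ∈ W, Adj W z (conj ζ * z))
    {p z : ℂ} (hp : p ∈ W) (hp0 : p ≠ 0) (hz : z ∈ W) : ∃ k : ℕ, z = ζ ^ k * p := by
  have hord := exists_pow_eq_one H.finite hadj hp hp0
  have hsub : range (fun k : ℕ => ζ ^ k * p) ⊆ W :=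
    range_subset_iff.2 fun k => pow_mul_mem hadj hp k
  obtain ⟨m, ⟨k, rfl⟩, hmax⟩ := (H.finite.subset hsub).exists_maximalFor (fun w => ⟪z, w⟫) _
    (range_nonempty _)
  simp only at hmax
  have hmax' : ∀ j : ℕ, ⟪z, ζ ^ j * p⟫ ≤ ⟪z, ζ ^ k * p⟫ := fun j => by
    by_contra hlt
    push Not at hlt
    exact absurd (hmax (mem_range_self j) hlt.le) (not_le.2 hlt)
  have hconj : conj ζ = ζ ^ (orderOf ζ - 1) := by
    have h1 : ζ * conj ζ = 1 := by rw [Complex.mul_conj, Complex.normSq_eq_norm_sq, hζ]; simp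
    have h2 : ζ * ζ ^ (orderOf ζ - 1) = 1 := by
      rw [mul_pow_sub_one hord.orderOf_pos.ne', pow_orderOf_eq_one]
    exact mul_left_cancel₀ (by rintro rfl; simp at him) (h1.trans h2.symm)
  have hmW := pow_mul_mem hadj hp k
  have hm1 := hmax' (k + 1)
  have hm2 := hmax' (orderOf ζ - 1 + k)
  rw [pow_succ', mul_assoc] at hm1
  rw [pow_add, ← hconj, mul_assoc] at hm2
  refine ⟨k, ?_⟩
  generalize ζ ^ k * p = m at hmW hm1 hm2
  have hm0 : m ≠ 0 := by
    rw [← norm_pos_iff, H.norm_eq m hmW, ← H.norm_eq p hp, norm_pos_iff]; exact hp0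
  have hne : ζ * m ≠ conj ζ * m := fun h =>
    him (Complex.conj_eq_iff_im.1 (mul_right_cancel₀ hm0 h).symm)
  obtain ⟨α, β, hαβ⟩ := exists_real_combination hζ him ((z - m) / m)
  have hcomb : z - m = α • (ζ * m - m) + β • (conj ζ * m - m) := by
    rw [div_eq_iff hm0] at hαβ
    rw [hαβ, Complex.real_smul, Complex.real_smul]
    ring
  have hβ : 0 ≤ β := coeff_nonneg (hadj m hmW)
    (fun c hc => by rw [hc]; simp [hne.symm, (hadj' m hmW).1.symm])
    (hadj' m hmW).right_mem hz hcomb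
  have hα : 0 ≤ α := coeff_nonneg (hadj' m hmW)
    (fun c hc => by rw [hc]; simp [hne, (hadj m hmW).1.symm])
    (hadj m hmW).right_mem hz (by rw [hcomb, add_comm])
  have hle : ⟪z, z - m⟫ ≤ 0 := by
    rw [hcomb, inner_add_right, inner_smul_right, inner_smul_right, inner_sub_right,
      inner_sub_right]
    nlinarith
  rw [inner_sub_right, sub_nonpos] at hle
  exact (eq_of_inner_ge (H.norm_eq z hz) (H.norm_eq m hmW) hle).symm

end Rotation

theorem sub_smul_eq_conj {p q : ℂ} (hpq : p ≠ q) (hp0 : p ≠ 0) (h : ‖p‖ = ‖q‖) (z : ℂ) :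
    z - (2 * ⟪p - q, z⟫ / ⟪p - q, p - q⟫) • (p - q) = q / conj p * conj z := by
  have hc0 : conj p ≠ 0 := by simpa using hp0
  have hn : p * conj p = q * conj q := by
    rw [Complex.mul_conj, Complex.mul_conj, Complex.normSq_eq_norm_sq, h,
      Complex.normSq_eq_norm_sq]
  have hd : p - q ≠ 0 := sub_ne_zero.2 hpq
  have hd' : conj (p - q) ≠ 0 := (map_ne_zero _).2 hd
  have e1 : ((2 * ⟪p - q, z⟫ : ℝ) : ℂ) = z * conj (p - q) + conj z * (p - q) := by
    rw [Complex.inner]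
    apply Complex.ext <;> simp <;> ring
  have e2 : ((⟪p - q, p - q⟫ : ℝ) : ℂ) = (p - q) * conj (p - q) := by
    rw [Complex.inner]
    apply Complex.ext <;> simp; ring
  rw [Complex.real_smul, Complex.ofReal_div, e1, e2]
  field_simp
  rw [map_sub]
  linear_combination (-conj z) * hn

/-- An inscribed bipartite polygon is centrally symmetric, symmetric under the reflections that
exchange the endpoints of an edge, and all its chords of the length of an edge are edges. -/
theorem InscribedBipartite.planar (H : InscribedBipartite W r ℓ col)
    (h3 : ∀ p q, ¬ W ⊆ {p, q}) :
    (∀ z ∈ W, -z ∈ W) ∧ (∀ z ∈ W, ∀ a ∈ W, ‖z - a‖ = ℓ → Adj W z a) ∧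
      ∀ p ∈ W, ∀ q ∈ W, p ≠ q → ∀ z ∈ W,
        z - (2 * ⟪p - q, z⟫ / ⟪p - q, p - q⟫) • (p - q) ∈ W := by
  obtain ⟨ζ, hζ, him, hadj, hadj', hall⟩ := exists_rotation H h3
  have hW0 : ∀ z ∈ W, z ≠ 0 := by
    rintro _ hz rfl
    refine h3 0 0 fun w hw => Or.inl ?_
    rw [← norm_eq_zero, H.norm_eq w hw, ← H.norm_eq 0 hz, norm_zero]
  refine ⟨fun z hz => neg_mem_of_rotation H hadj hz (hW0 z hz), fun z hz a ha h => ?_,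
    fun p hp q hq hpq z hz => ?_⟩
  · rcases hall z a hz ha h with rfl | rfl
    · exact hadj z hz
    · exact hadj' z hz
  · rw [sub_smul_eq_conj hpq (hW0 p hp) (by rw [H.norm_eq p hp, H.norm_eq q hq])]
    obtain ⟨k, rfl⟩ := mem_orbit_of_rotation H hζ him hadj hadj' hp (hW0 p hp) hz
    have : q / conj p * conj (ζ ^ k * p) = conj ζ ^ k * q := by
      have : conj p ≠ 0 := by simpa using hW0 p hp
      rw [map_mul, map_pow]
      field_simp
    rw [this]
    exact pow_mul_mem hadj' hq k

end Plane

section Global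

variable {E : Type*} [NormedAddCommGroup E] [InnerProductSpace ℝ E]

/-- The reflection in the hyperplane orthogonal to `u`. -/
def hyperplaneReflection (u : E) : E ≃ₗᵢ[ℝ] E := (ℝ ∙ u)ᗮ.reflection

theorem hyperplaneReflection_apply (u x : E) :
    hyperplaneReflection u x = x - (2 * ⟪u, x⟫ / ⟪u, u⟫) • u := by
  rw [hyperplaneReflection, Submodule.reflection_orthogonal_apply,
    Submodule.reflection_singleton_apply, neg_sub, real_inner_self_eq_norm_sq, mul_div_assoc,
    mul_smul, ofNat_smul_eq_nsmul ℝ 2]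
  rfl

theorem hyperplaneReflection_self (u : E) : hyperplaneReflection u u = -u :=
  Submodule.reflection_orthogonalComplement_singleton_eq_neg u

theorem hyperplaneReflection_of_inner_eq_zero {u x : E} (h : ⟪u, x⟫ = 0) :
    hyperplaneReflection u x = x := by
  rw [hyperplaneReflection_apply, h]; simp

@[simp]
theorem hyperplaneReflection_hyperplaneReflection (u x : E) :
    hyperplaneReflection u (hyperplaneReflection u x) = x :=
  Submodule.reflection_reflection _ _

theorem inner_hyperplaneReflection (u x y : E) :
    ⟪hyperplaneReflection u x, y⟫ = ⟪x, hyperplaneReflection u y⟫ := by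
  rw [← (hyperplaneReflection u).inner_map_map x, hyperplaneReflection_hyperplaneReflection]

theorem hyperplaneReflection_smul {t : ℝ} (ht : t ≠ 0) (u : E) :
    hyperplaneReflection (t • u) = hyperplaneReflection u := by
  rw [hyperplaneReflection, hyperplaneReflection]
  congr 2
  exact Submodule.span_singleton_smul_eq (IsUnit.mk0 t ht) u

theorem hyperplaneReflection_sub {v w : E} (h : ‖v‖ = ‖w‖) :
    hyperplaneReflection (v - w) v = w := Submodule.reflection_sub h

/-- An inscribed bipartite set of dimension two is centrally symmetric, symmetric under the
reflections that exchange the endpoints of an edge, and all its chords of the length of an edge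
are edges. -/
theorem InscribedBipartite.of_finrank_eq_two {W : Set E} {r ℓ : ℝ} {col : Set E}
    (H : InscribedBipartite W r ℓ col) (h3 : ∀ p q, ¬ W ⊆ {p, q}) {L : Submodule ℝ E}
    (hL : Module.finrank ℝ L = 2) (hWL : ∀ v ∈ W, ∀ w ∈ W, v - w ∈ L) :
    (∃ o, ∀ w ∈ W, o - w ∈ W) ∧ (∀ v ∈ W, ∀ w ∈ W, ‖v - w‖ = ℓ → Adj W v w) ∧
      ∀ p ∈ W, ∀ q ∈ W, p ≠ q → ∀ w ∈ W, hyperplaneReflection (p - q) w ∈ W := by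
  have : FiniteDimensional ℝ L := FiniteDimensional.of_finrank_pos (by omega)
  obtain ⟨w₀, hw₀⟩ : W.Nonempty := by
    rw [nonempty_iff_ne_empty]
    rintro rfl
    exact h3 0 0 (empty_subset _)
  let φ := Complex.isometryOfOrthonormal ((stdOrthonormalBasis ℝ L).reindex (finCongr hL))
  let ψ : ℂ →ₗᵢ[ℝ] E := L.subtypeₗᵢ.comp φ.toLinearIsometry
  have hψL : ∀ z, ψ z ∈ L := fun z => (φ z).2
  have hLψ : ∀ x ∈ L, ∃ z, ψ z = x := fun x hx => ⟨φ.symm ⟨x, hx⟩, by simp [ψ]⟩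
  clear_value ψ
  obtain ⟨o, hoL, ho⟩ : ∃ o ∈ Lᗮ, w₀ - o ∈ L :=
    ⟨w₀ - L.starProjection w₀, Submodule.sub_starProjection_mem_orthogonal w₀, by simp⟩
  have hrep : ∀ w ∈ W, ∃ z, w = o + ψ z := fun w hw => by
    obtain ⟨z, hz⟩ := hLψ (w - o) (by simpa using L.add_mem (hWL w hw w₀ hw₀) ho)
    exact ⟨z, by rw [hz]; abel⟩
  have hoψ : ∀ z, ⟪ψ z, o⟫ = 0 := fun z => hoL _ (hψL z)
  have hinner : ∀ c z, ⟪ψ c, o + ψ z⟫ = ⟪c, z⟫ := fun c z => by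
    rw [inner_add_right, hoψ, ψ.inner_map_map, zero_add]
  set W' : Set ℂ := {z | o + ψ z ∈ W} with hW'
  have hinj : Function.Injective fun z => o + ψ z := fun a b h => ψ.injective (add_left_cancel h)
  have hface : ∀ c z, z ∈ face W' c ↔ o + ψ z ∈ face W (ψ c) := by
    intro c z
    refine and_congr Iff.rfl ⟨fun h w hw => ?_, fun h w hw => ?_⟩
    · obtain ⟨a, rfl⟩ := hrep w hw
      rw [hinner, hinner]
      exact h a hw
    · simpa only [hinner] using h _ hw
  have hadj : ∀ z a, Adj W' z a → Adj W (o + ψ z) (o + ψ a) := by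
    rintro z a ⟨hne, c, hc⟩
    refine ⟨fun h => hne (hinj h), ψ c, ?_⟩
    ext w
    constructor
    · intro hw
      obtain ⟨b, rfl⟩ := hrep w hw.1
      have := (hface c b).2 hw
      rw [hc] at this
      rcases this with rfl | rfl
      · exact Or.inl rfl
      · exact Or.inr rfl
    · rintro (rfl | rfl)
      · exact (hface c z).1 (hc ▸ mem_insert _ _)
      · exact (hface c a).1 (hc ▸ mem_insert_of_mem _ rfl)
  have hdist : ∀ z a, ‖o + ψ z - (o + ψ a)‖ = ‖z - a‖ := fun z a => by
    rw [add_sub_add_left_eq_sub, ← map_sub, ψ.norm_map]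
  have H' : InscribedBipartite W' (√(r ^ 2 - ‖o‖ ^ 2)) ℓ {z | o + ψ z ∈ col} :=
    { finite := H.finite.preimage hinj.injOn
      norm_eq := fun z hz => by
        rw [← H.norm_eq _ hz, norm_add_sq_real, real_inner_comm, hoψ, ψ.norm_map]
        simp
      norm_sub_eq := fun z a h => by rw [← hdist, H.norm_sub_eq _ _ (hadj z a h)]
      mem_iff := fun z a h => H.mem_iff _ _ (hadj z a h) }
  have h3' : ∀ p q, ¬ W' ⊆ {p, q} := fun p q hsub => h3 (o + ψ p) (o + ψ q) fun w hw => by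
    obtain ⟨z, rfl⟩ := hrep w hw
    rcases hsub hw with rfl | rfl
    · exact Or.inl rfl
    · exact Or.inr rfl
  obtain ⟨h1, h2, h4⟩ := H'.planar h3'
  refine ⟨⟨o + o, fun w hw => ?_⟩, fun v hv w hw h => ?_, fun p hp q hq hpq w hw => ?_⟩
  · obtain ⟨z, rfl⟩ := hrep w hw
    have := h1 z hw
    rw [hW', mem_ofPred_eq, map_neg] at this
    convert this using 1
    abel
  · obtain ⟨z, rfl⟩ := hrep v hv
    obtain ⟨a, rfl⟩ := hrep w hw
    exact hadj _ _ (h2 z hv a hw (by rwa [← hdist]))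
  · obtain ⟨a, rfl⟩ := hrep p hp
    obtain ⟨b, rfl⟩ := hrep q hq
    obtain ⟨z, rfl⟩ := hrep w hw
    have := h4 a hp b hq (fun h => hpq (by rw [h])) z hw
    rw [hyperplaneReflection_apply, add_sub_add_left_eq_sub, ← map_sub, hinner,
      ψ.inner_map_map, add_sub_assoc, ← map_smul, ← map_sub]
    exact this

theorem exists_pair_mem_face_of_scaled {W : Set E} {c c' : E} {κ : ℝ}
    (hκ : 0 < κ ∨ κ < 0 ∧ ∃ o, ∀ w ∈ W, o - w ∈ W)
    (h : ∀ v ∈ W, ∀ w ∈ W, ⟪c', v - w⟫ = κ * ⟪c, v - w⟫)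
    (hc : ∃ p ∈ face W c, ∃ q ∈ face W c, p ≠ q) :
    ∃ p ∈ face W c', ∃ q ∈ face W c', p ≠ q := by
  obtain ⟨p, hp, q, hq, hpq⟩ := hc
  rcases hκ with hκ | ⟨hκ, o, ho⟩
  · have key : face W c ⊆ face W c' := by
      rintro v ⟨hv, hmax⟩
      refine ⟨hv, fun w hw => ?_⟩
      have h1 := h w hw v hv
      rw [inner_sub_right, inner_sub_right] at h1
      nlinarith [hmax w hw]
    exact ⟨p, key hp, q, key hq, hpq⟩
  · have key : ∀ v ∈ face W c, o - v ∈ face W c' := by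
      rintro v ⟨hv, hmax⟩
      refine ⟨ho v hv, fun w hw => ?_⟩
      have h1 := h v hv (o - w) (ho w hw)
      have h2 := hmax (o - w) (ho w hw)
      simp only [inner_sub_right] at h1 h2 ⊢
      nlinarith
    exact ⟨o - p, key p hp, o - q, key q hq, fun h => hpq (sub_right_injective h)⟩

omit [InnerProductSpace ℝ E] in
theorem exists_center_of_subset_pair {W : Set E} {p q : E} (h : W ⊆ {p, q}) :
    ∃ o, ∀ w ∈ W, o - w ∈ W := by
  rcases subset_pair_iff_eq.1 h with rfl | rfl | rfl | rfl
  · simp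
  · exact ⟨p + p, by simp⟩
  · exact ⟨q + q, by simp⟩
  · exact ⟨p + q, by simp⟩

theorem face_eq_pair {V : Set E} {r : ℝ} (hV : ∀ v ∈ V, ‖v‖ = r) {c u p q : E}
    (h : ∀ v ∈ face V c, ∀ w ∈ face V c, ∃ t : ℝ, v - w = t • u)
    (hp : p ∈ face V c) (hq : q ∈ face V c) (hpq : p ≠ q) : face V c = {p, q} := by
  refine Subset.antisymm (fun z hz => ?_) (pair_subset hp hq)
  obtain ⟨t, ht⟩ := h q hq p hp
  obtain ⟨s, hs⟩ := h z hz p hp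
  have ht0 : t ≠ 0 := by
    rintro rfl
    rw [zero_smul, sub_eq_zero] at ht
    exact hpq ht.symm
  refine eq_or_eq_of_norm_eq (t := s / t) (hV p hp.1) (hV q hq.1) (hV z hz.1) hpq ?_
  rw [hs, ht, smul_smul, div_mul_cancel₀ _ ht0]

open Submodule in
theorem mem_span_of_orthogonalProjection_eq {u a d : E} {t : ℝ}
    (h : (ℝ ∙ u)ᗮ.orthogonalProjectionOnto d = t • (ℝ ∙ u)ᗮ.orthogonalProjectionOnto a) :
    ∃ s : ℝ, d = s • u + t • a := by
  rw [← map_smul, ← sub_eq_zero, ← map_sub, orthogonalProjectionOnto_eq_zero_iff,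
    orthogonal_orthogonal, mem_span_singleton] at h
  obtain ⟨s, hs⟩ := h
  exact ⟨s, by rw [hs]; abel⟩

open Submodule in
/-- If `u` is an edge vector, then every face whose normal is orthogonal to `u` contains an edge
with edge vector `u`. -/
theorem InscribedBipartite.exists_adj_mem_face {V : Set E} {r ℓ : ℝ} {col : Set E}
    (H : InscribedBipartite V r ℓ col) {v₀ w₀ : E} (h₀ : Adj V v₀ w₀) {c : E}
    (hc : ⟪v₀ - w₀, c⟫ = 0) :
    ∃ p ∈ face V c, ∃ q ∈ face V c, Adj V p q ∧ p - q = v₀ - w₀ := by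
  set u := v₀ - w₀ with hu
  have hu0 : u ≠ 0 := sub_ne_zero.2 h₀.1
  set K := (ℝ ∙ u)ᗮ with hK
  have hKu : ∀ x : K, ⟪u, (x : E)⟫ = 0 := fun x => mem_orthogonal_singleton_iff_inner_right.1 x.2
  set A : Set K := (K.orthogonalProjectionOnto '' (V - V)) \ {0} with hA
  have hAfin : A.Finite := ((H.finite.sub H.finite).image _).subset sdiff_subset
  have hA0 : (0 : K) ∉ A := by simp [hA]
  have hπ : ∀ (d : E) (x : K), ⟪K.orthogonalProjectionOnto d, x⟫ = ⟪d, (x : E)⟫ := fun d x => by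
    rw [real_inner_comm, inner_orthogonalProjectionOnto_eq_of_mem_left, real_inner_comm]
  have hmem : ∀ {x : E}, ∀ v ∈ face V x, ∀ w ∈ face V x, v - w ∈ V - V :=
    fun v hv w hw => sub_mem_sub hv.1 hw.1
  have hcoe : ∀ x : K, Tendsto (fun y : K => (y : E)) (𝓝 x) (𝓝 (x : E)) :=
    fun x => continuous_subtype_val.tendsto x
  set S : K → Prop := fun x => ∃ p ∈ face V x, ∃ q ∈ face V x, p ≠ q with hS
  have hloc : ∀ x : K, (∀ a ∈ A, ∀ b ∈ A, ⟪a, x⟫ = 0 → ⟪b, x⟫ = 0 → ∃ t : ℝ, b = t • a) →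
      (∀ᶠ y in 𝓝 x, Avoids A y → S y) ∨ (∀ᶠ y in 𝓝 x, Avoids A y → ¬ S y) := by
    intro x hx
    have hscale : ∀ y z : K, Avoids A y → Avoids A z → ∃ κ : ℝ,
        (0 < κ ∨ κ < 0 ∧ ∃ o, ∀ w ∈ face V (x : E), o - w ∈ face V (x : E)) ∧
        ∀ v ∈ face V (x : E), ∀ w ∈ face V (x : E),
          ⟪(z : E), v - w⟫ = κ * ⟪(y : E), v - w⟫ := by
      intro y z hy hz
      by_cases hex : ∃ a ∈ V - V, K.orthogonalProjectionOnto a ≠ 0 ∧ ⟪a, (x : E)⟫ = 0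
      · obtain ⟨a, haV, ha0, hax⟩ := hex
        have haA : K.orthogonalProjectionOnto a ∈ A := ⟨mem_image_of_mem _ haV, ha0⟩
        have hya : ⟪a, (y : E)⟫ ≠ 0 := by rw [← hπ]; exact hy _ haA
        have hza : ⟪a, (z : E)⟫ ≠ 0 := by rw [← hπ]; exact hz _ haA
        have hrep : ∀ v ∈ face V (x : E), ∀ w ∈ face V (x : E),
            ∃ s t : ℝ, v - w = s • u + t • a := by
          intro v hv w hw
          have h0 := inner_sub_eq_zero_of_mem_face hv hw
          by_cases hd : K.orthogonalProjectionOnto (v - w) = 0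
          · obtain ⟨s, hs⟩ := mem_span_of_orthogonalProjection_eq (t := 0) (a := a)
              (by rw [hd, zero_smul])
            exact ⟨s, 0, hs⟩
          · obtain ⟨t, ht⟩ := hx _ haA _ ⟨mem_image_of_mem _ (hmem v hv w hw), hd⟩
              (by rw [hπ, hax]) (by rw [hπ, h0])
            obtain ⟨s, hs⟩ := mem_span_of_orthogonalProjection_eq ht
            exact ⟨s, t, hs⟩
        have hcenter : ∃ o, ∀ w ∈ face V (x : E), o - w ∈ face V (x : E) := by
          by_cases h3 : ∀ p q, ¬ face V (x : E) ⊆ {p, q}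
          · have hind : LinearIndependent ℝ ![u, a] := by
              refine (LinearIndependent.pair_iff' hu0).2 fun t ht => ha0 ?_
              rw [← ht, orthogonalProjectionOnto_eq_zero_iff, hK, orthogonal_orthogonal]
              exact smul_mem _ _ (mem_span_singleton_self u)
            have hrank := finrank_span_eq_card hind
            rw [Fintype.card_fin, Matrix.range_cons_cons_empty] at hrank
            refine ((H.restrict_face _).of_finrank_eq_two h3 hrank fun v hv w hw => ?_).1
            obtain ⟨s, t, h⟩ := hrep v hv w hw
            exact mem_span_pair.2 ⟨s, t, h.symm⟩
          · push Not at h3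
            obtain ⟨p, q, h⟩ := h3
            exact exists_center_of_subset_pair h
        refine ⟨⟪a, (z : E)⟫ / ⟪a, (y : E)⟫, ?_, fun v hv w hw => ?_⟩
        · rcases lt_or_gt_of_ne (div_ne_zero hza hya) with h | h
          · exact Or.inr ⟨h, hcenter⟩
          · exact Or.inl h
        · obtain ⟨s, t, h⟩ := hrep v hv w hw
          rw [h, real_inner_comm, real_inner_comm _ (y : E), inner_add_left, inner_add_left,
            inner_smul_left, inner_smul_left, inner_smul_left, inner_smul_left, hKu, hKu]
          simp only [conj_trivial]
          field_simp
          ring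
      · push Not at hex
        refine ⟨1, Or.inl one_pos, fun v hv w hw => ?_⟩
        have hd : K.orthogonalProjectionOnto (v - w) = 0 := by
          by_contra hd
          exact hex _ (hmem v hv w hw) hd (inner_sub_eq_zero_of_mem_face hv hw)
        rw [real_inner_comm, real_inner_comm _ (y : E), ← hπ, ← hπ, hd]
        simp
    have hev := (hcoe x).eventually (eventually_face_eq H.finite (x : E))
    by_cases hex : ∃ y : K, face V (y : E) = face (face V (x : E)) y ∧ Avoids A y ∧ S y
    · left
      obtain ⟨y, hy, hyA, hyS⟩ := hex
      filter_upwards [hev] with z hz hzA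
      obtain ⟨κ, hκ, h⟩ := hscale y z hyA hzA
      rw [hS] at hyS ⊢
      simp only [hy, hz] at hyS ⊢
      exact exists_pair_mem_face_of_scaled hκ h hyS
    · right
      push Not at hex
      filter_upwards [hev] with z hz hzA
      exact hex z hz hzA
  obtain ⟨c₀, hc₀⟩ := h₀.2
  have hc₀K : c₀ ∈ K := by
    rw [hK, mem_orthogonal_singleton_iff_inner_right]
    exact inner_sub_eq_zero_of_mem_face (hc₀ ▸ mem_insert _ _) (hc₀ ▸ mem_insert_of_mem _ rfl)
  obtain ⟨c₁, hc₁, hc₁A⟩ := exists_avoids_of_eventually hAfin hA0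
    ((hcoe ⟨c₀, hc₀K⟩).eventually (eventually_face_eq H.finite c₀))
  have hc₁S : S c₁ := by
    have hval : ⟪(c₁ : E), v₀⟫ = ⟪(c₁ : E), w₀⟫ := by
      have := hKu c₁
      rwa [hu, real_inner_comm, inner_sub_right, sub_eq_zero] at this
    rw [hS]
    simp only [hc₁, hc₀]
    refine ⟨v₀, ⟨mem_insert _ _, ?_⟩, w₀, ⟨mem_insert_of_mem _ rfl, ?_⟩, h₀.1⟩ <;> simp [hval]
  have hcK : c ∈ K := mem_orthogonal_singleton_iff_inner_right.2 hc
  obtain ⟨c₂, hc₂, hc₂A⟩ := exists_avoids_of_eventually hAfin hA0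
    ((hcoe ⟨c, hcK⟩).eventually (eventually_face_subset H.finite c))
  obtain ⟨p, hp, q, hq, hpq⟩ := avoids_induction hAfin hA0 S hloc hc₁A hc₁S hc₂A
  have hpar : ∀ v ∈ face V (c₂ : E), ∀ w ∈ face V (c₂ : E), ∃ t : ℝ, v - w = t • u := by
    intro v hv w hw
    have hd : K.orthogonalProjectionOnto (v - w) = 0 := by
      by_contra hd
      exact hc₂A _ ⟨mem_image_of_mem _ (hmem v hv w hw), hd⟩
        (by rw [hπ, inner_sub_eq_zero_of_mem_face hv hw])
    obtain ⟨s, hs⟩ := mem_span_of_orthogonalProjection_eq (u := u) (t := 0) (a := 0)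
      (d := v - w) (by rw [hd, zero_smul])
    exact ⟨s, by rw [hs]; simp⟩
  have hadj : Adj V p q := ⟨hpq, c₂, face_eq_pair H.norm_eq hpar hp hq hpq⟩
  obtain ⟨t, ht⟩ := hpar p hp q hq
  have hlen : |t| * ‖u‖ = ‖u‖ := by
    rw [← Real.norm_eq_abs, ← norm_smul, ← ht, H.norm_sub_eq p q hadj, hu, H.norm_sub_eq _ _ h₀]
  have habs : |t| = 1 := mul_right_cancel₀ (norm_ne_zero_iff.2 hu0) (by rw [hlen, one_mul])
  rcases eq_or_eq_neg_of_abs_eq habs with rfl | rfl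
  · exact ⟨p, hc₂ hp, q, hc₂ hq, hadj, by rw [ht, one_smul]⟩
  · exact ⟨q, hc₂ hq, p, hc₂ hp, hadj.symm, by rw [← neg_sub, ht, neg_smul, one_smul, neg_neg]⟩

end Global

section Symmetry

variable {E : Type*} [NormedAddCommGroup E] [InnerProductSpace ℝ E]

/-- `u` is the difference of the two ends of an edge. -/
def IsEdgeVec (V : Set E) (u : E) : Prop := ∃ v w, Adj V v w ∧ v - w = u

theorem IsEdgeVec.neg {V : Set E} {u : E} (h : IsEdgeVec V u) : IsEdgeVec V (-u) := by
  obtain ⟨v, w, h, rfl⟩ := h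
  exact ⟨w, v, h.symm, (neg_sub v w).symm⟩

theorem IsEdgeVec.ne_zero {V : Set E} {u : E} (h : IsEdgeVec V u) : u ≠ 0 := by
  obtain ⟨v, w, h, rfl⟩ := h
  exact sub_ne_zero.2 h.1

variable {V : Set E} {r ℓ : ℝ} {col : Set E}

theorem InscribedBipartite.exists_adj_of_isEdgeVec (H : InscribedBipartite V r ℓ col) {u c : E}
    (hu : IsEdgeVec V u) (hc : ⟪u, c⟫ = 0) :
    ∃ p ∈ face V c, ∃ q ∈ face V c, Adj V p q ∧ p - q = u := by
  obtain ⟨v, w, h, rfl⟩ := hu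
  exact H.exists_adj_mem_face h hc

open Submodule in
theorem InscribedBipartite.isEdgeVec_hyperplaneReflection [FiniteDimensional ℝ E]
    (H : InscribedBipartite V r ℓ col) {u u' : E} (hu : IsEdgeVec V u) (hu' : IsEdgeVec V u') :
    IsEdgeVec V (hyperplaneReflection u u') := by
  by_cases hpar : ∃ t : ℝ, t • u = u'
  · obtain ⟨t, rfl⟩ := hpar
    rw [map_smul, hyperplaneReflection_self, smul_neg]
    exact hu'.neg
  push Not at hpar
  have hrank := finrank_span_eq_card ((LinearIndependent.pair_iff' hu.ne_zero).2 hpar)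
  rw [Fintype.card_fin, Matrix.range_cons_cons_empty] at hrank
  set L := span ℝ {u, u'} with hL
  set A : Set Lᗮ := (Lᗮ.orthogonalProjectionOnto '' (V - V)) \ {0} with hA
  obtain ⟨x, hx⟩ := (dense_avoids (A := A)
    (((H.finite.sub H.finite).image _).subset sdiff_subset) (by simp [hA])).nonempty
  have hWL : ∀ v ∈ face V (x : E), ∀ w ∈ face V (x : E), v - w ∈ L := by
    intro v hv w hw
    rw [← orthogonal_orthogonal L, ← orthogonalProjectionOnto_eq_zero_iff]
    by_contra hd
    refine hx _ ⟨mem_image_of_mem _ (sub_mem_sub hv.1 hw.1), hd⟩ ?_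
    rw [real_inner_comm, inner_orthogonalProjectionOnto_eq_of_mem_left, real_inner_comm]
    exact inner_sub_eq_zero_of_mem_face hv hw
  obtain ⟨p, hp, q, hq, -, rfl⟩ := H.exists_adj_of_isEdgeVec hu
    (x.2 u (subset_span (mem_insert _ _)))
  obtain ⟨p', hp', q', hq', hadj, rfl⟩ := H.exists_adj_of_isEdgeVec hu'
    (x.2 u' (subset_span (mem_insert_of_mem _ rfl)))
  have hpq : p ≠ q := sub_ne_zero.1 hu.ne_zero
  have h3 : ∀ a b, ¬ face V (x : E) ⊆ {a, b} := by
    intro a b h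
    have h1 := hpar 1
    have h2 := hpar (-1)
    rw [one_smul] at h1
    rw [neg_one_smul, neg_sub] at h2
    rcases h hp with rfl | rfl <;> rcases h hq with rfl | rfl <;>
      rcases h hp' with rfl | rfl <;> rcases h hq' with rfl | rfl <;>
      first | exact hpq rfl | exact hadj.1 rfl | exact h1 rfl | exact h2 rfl
  obtain ⟨-, hedge, hrefl⟩ := (H.restrict_face (x : E)).of_finrank_eq_two h3 hrank hWL
  refine ⟨_, _, (hedge _ (hrefl p hp q hq hpq p' hp') _ (hrefl p hp q hq hpq q' hq') ?_).of_face
    H.finite, (map_sub _ _ _).symm⟩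
  rw [← map_sub, LinearIsometryEquiv.norm_map, H.norm_sub_eq _ _ hadj]

theorem face_pair_of_lt {c p q : E} (h : ⟪c, q⟫ < ⟪c, p⟫) : face {p, q} c = {p} := by
  ext v
  constructor
  · rintro ⟨rfl | rfl, hv⟩
    · rfl
    · exact absurd (hv p (mem_insert _ _)) (not_le.2 h)
  · rintro rfl
    exact ⟨mem_insert _ _, by simp [h.le]⟩

theorem face_singleton (c p : E) : face {p} c = {p} := by
  ext v
  constructor
  · exact fun h => h.1
  · rintro rfl
    exact ⟨rfl, by simp⟩

theorem exists_face_eq_singleton (hV : V.Finite) (hne : V.Nonempty) {c : E}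
    (h : (face V c).Subsingleton) : ∃ v, face V c = {v} := by
  obtain ⟨v, hv⟩ := face_nonempty hV hne c
  exact ⟨v, h.eq_singleton_of_mem hv⟩

/-- An inscribed bipartite set is symmetric under the reflections in its edge vectors. -/
theorem InscribedBipartite.hyperplaneReflection_mem [FiniteDimensional ℝ E]
    (H : InscribedBipartite V r ℓ col) {u : E} (hu : IsEdgeVec V u) {v : E} (hv : v ∈ V) :
    hyperplaneReflection u v ∈ V := by
  set R := hyperplaneReflection u with hR
  have hRR : ∀ x, R (R x) = x := hyperplaneReflection_hyperplaneReflection u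
  have hRinner : ∀ x y, ⟪R x, y⟫ = ⟪x, R y⟫ := inner_hyperplaneReflection u
  set A : Set E := ((V - V) ∪ R '' (V - V)) \ {0} with hA
  have hAfin : A.Finite := ((H.finite.sub H.finite).union
    ((H.finite.sub H.finite).image _)).subset sdiff_subset
  have hA0 : (0 : E) ∉ A := by simp [hA]
  have hRtend : ∀ c, Tendsto R (𝓝 c) (𝓝 (R c)) := fun c => R.continuous.tendsto c
  have hmem : ∀ {c p q : E}, p ∈ face V c → q ∈ face V c → p ≠ q → p - q ∈ A :=
    fun hp hq h => ⟨Or.inl (sub_mem_sub hp.1 hq.1), sub_ne_zero.2 h⟩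
  have hRmem : ∀ {c p q : E}, p ∈ face V c → q ∈ face V c → p ≠ q → R (p - q) ∈ A :=
    fun hp hq h => ⟨Or.inr (mem_image_of_mem _ (sub_mem_sub hp.1 hq.1)),
      fun h0 => sub_ne_zero.2 h ((map_eq_zero_iff R R.injective).1 h0)⟩
  have hD : ∀ {e}, IsEdgeVec V e → IsEdgeVec V (R e) :=
    fun he => H.isEdgeVec_hyperplaneReflection hu he
  set S : E → Prop := fun c => ∃ w, face V c = {w} ∧ face V (R c) = {R w} with hS
  have hev : ∀ c, ∀ᶠ y in 𝓝 c, face V y = face (face V c) y ∧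
      face V (R y) = face (face V (R c)) (R y) := fun c =>
    (eventually_face_eq H.finite c).and ((hRtend c).eventually (eventually_face_eq H.finite (R c)))
  have hpair : ∀ c, (∀ a ∈ A, ∀ b ∈ A, ⟪a, c⟫ = 0 → ⟪b, c⟫ = 0 → ∃ t : ℝ, b = t • a) →
      ∀ p ∈ face V c, ∀ q ∈ face V c, p ≠ q → face V c = {p, q} ∧ IsEdgeVec V (p - q) := by
    intro c hc p hp q hq hpq
    have : face V c = {p, q} := by
      refine face_eq_pair (u := p - q) H.norm_eq (fun a ha b hb => ?_) hp hq hpq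
      by_cases hab : a = b
      · exact ⟨0, by simp [hab]⟩
      · exact hc _ (hmem hp hq hpq) _ (hmem ha hb hab) (inner_sub_eq_zero_of_mem_face hp hq)
          (inner_sub_eq_zero_of_mem_face ha hb)
    exact ⟨this, p, q, ⟨hpq, c, this⟩, rfl⟩
  have hloc : ∀ c, (∀ a ∈ A, ∀ b ∈ A, ⟪a, c⟫ = 0 → ⟪b, c⟫ = 0 → ∃ t : ℝ, b = t • a) →
      (∀ᶠ y in 𝓝 c, Avoids A y → S y) ∨ (∀ᶠ y in 𝓝 c, Avoids A y → ¬ S y) := by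
    intro c hc
    have hc' : ∀ p ∈ face V (R c), ∀ q ∈ face V (R c), p ≠ q →
        face V (R c) = {p, q} ∧ IsEdgeVec V (p - q) := by
      intro p hp q hq hpq
      have : face V (R c) = {p, q} := by
        refine face_eq_pair (u := p - q) H.norm_eq (fun a ha b hb => ?_) hp hq hpq
        by_cases hab : a = b
        · exact ⟨0, by simp [hab]⟩
        · obtain ⟨t, ht⟩ := hc _ (hRmem hp hq hpq) _ (hRmem ha hb hab)
            (by rw [hRinner, inner_sub_eq_zero_of_mem_face hp hq])
            (by rw [hRinner, inner_sub_eq_zero_of_mem_face ha hb])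
          exact ⟨t, R.injective (by rw [ht, map_smul])⟩
      exact ⟨this, p, q, ⟨hpq, R c, this⟩, rfl⟩
    by_cases hF : (face V c).Subsingleton
    · have hF' : (face V (R c)).Subsingleton := by
        intro p hp q hq
        by_contra hpq
        obtain ⟨a, ha, b, hb, hab, -⟩ := H.exists_adj_of_isEdgeVec (c := c) (hD (hc' p hp q hq hpq).2)
          (by rw [hRinner, inner_sub_eq_zero_of_mem_face hp hq])
        exact hab.1 (hF ha hb)
      obtain ⟨a, ha⟩ := exists_face_eq_singleton H.finite ⟨v, hv⟩ hF
      obtain ⟨b, hb⟩ := exists_face_eq_singleton H.finite ⟨v, hv⟩ hF'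
      have key : ∀ᶠ y in 𝓝 c, S y ↔ b = R a := by
        filter_upwards [hev c] with y ⟨h1, h2⟩
        rw [ha, face_singleton] at h1
        rw [hb, face_singleton] at h2
        simp [hS, h1, h2]
      by_cases h : b = R a
      · exact Or.inl (key.mono fun y hy _ => hy.2 h)
      · exact Or.inr (key.mono fun y hy _ hSy => h (hy.1 hSy))
    · rw [not_subsingleton_iff] at hF
      obtain ⟨p, hp, q, hq, hpq⟩ := hF
      obtain ⟨hFpq, hδ⟩ := hpair c hc p hp q hq hpq
      obtain ⟨p', hp', q', hq', hadj, hδ'⟩ := H.exists_adj_of_isEdgeVec (c := R c) (hD hδ)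
        (by rw [R.inner_map_map, inner_sub_eq_zero_of_mem_face hp hq])
      have hF' := (hc' p' hp' q' hq' hadj.1).1
      have key : ∀ᶠ y in 𝓝 c, Avoids A y → (S y ↔ p' = R p) := by
        filter_upwards [hev c] with y ⟨h1, h2⟩ hy
        have hne := hy _ (hmem hp hq hpq)
        have heq : ⟪R y, p'⟫ - ⟪R y, q'⟫ = ⟪y, p⟫ - ⟪y, q⟫ := by
          rw [← inner_sub_right, hδ', R.inner_map_map, inner_sub_right]
        rw [real_inner_comm, inner_sub_right] at hne
        rw [hFpq] at h1
        rw [hF'] at h2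
        rcases lt_or_gt_of_ne hne with h | h
        · rw [pair_comm, face_pair_of_lt (by linarith)] at h1 h2
          have : q' = R q ↔ p' = R p := by
            rw [map_sub, sub_eq_sub_iff_add_eq_add] at hδ'
            constructor
            · rintro rfl
              simpa using hδ'
            · rintro rfl
              simpa using hδ'.symm
          simp [hS, h1, h2, this]
        · rw [face_pair_of_lt (by linarith)] at h1 h2
          simp [hS, h1, h2]
      by_cases h : p' = R p
      · exact Or.inl (key.mono fun y hy hyA => (hy hyA).2 h)
      · exact Or.inr (key.mono fun y hy hyA hSy => h ((hy hyA).1 hSy))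
  obtain ⟨a, b, ⟨hab, c₀, hc₀⟩, rfl⟩ := id hu
  have ha : a ∈ face V c₀ := hc₀ ▸ mem_insert _ _
  have hb : b ∈ face V c₀ := hc₀ ▸ mem_insert_of_mem _ rfl
  have hRc₀ : R c₀ = c₀ :=
    hyperplaneReflection_of_inner_eq_zero (inner_sub_eq_zero_of_mem_face ha hb)
  have hRa : R a = b :=
    hyperplaneReflection_sub (by rw [H.norm_eq a ha.1, H.norm_eq b hb.1])
  have hRb : R b = a := by rw [← hRa, hRR]
  obtain ⟨c₁, ⟨h1, h2⟩, hc₁A⟩ := exists_avoids_of_eventually hAfin hA0 (hev c₀)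
  have hc₁S : S c₁ := by
    have hne := hc₁A _ (hmem ha hb hab)
    rw [real_inner_comm, inner_sub_right] at hne
    rw [hc₀] at h1
    rw [hRc₀, hc₀] at h2
    have ea : ⟪R c₁, a⟫ = ⟪c₁, b⟫ := by rw [hRinner, hRa]
    have eb : ⟪R c₁, b⟫ = ⟪c₁, a⟫ := by rw [hRinner, hRb]
    rcases lt_or_gt_of_ne hne with h | h
    · rw [pair_comm, face_pair_of_lt (by linarith)] at h1
      rw [face_pair_of_lt (by linarith)] at h2
      exact ⟨b, h1, by rw [h2, hRb]⟩
    · rw [face_pair_of_lt (by linarith)] at h1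
      rw [pair_comm, face_pair_of_lt (by linarith)] at h2
      exact ⟨a, h1, by rw [h2, hRa]⟩
  obtain ⟨c₂, hc₂, hc₂A⟩ := exists_avoids_of_eventually hAfin hA0 (eventually_face_subset H.finite v)
  obtain ⟨w, hw, hw'⟩ := avoids_induction hAfin hA0 S hloc hc₁A hc₁S hc₂A
  rw [hw, face_self H.norm_eq hv, singleton_subset_singleton] at hc₂
  subst hc₂
  exact face_subset V (R c₂) (hw' ▸ rfl)

theorem InscribedBipartite.inner_ne_zero (H : InscribedBipartite V r ℓ col) {u v : E}
    (hu : IsEdgeVec V u) (hv : v ∈ V) : ⟪u, v⟫ ≠ 0 := by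
  intro h
  obtain ⟨p, hp, q, hq, hpq, -⟩ := H.exists_adj_of_isEdgeVec hu h
  rw [face_self H.norm_eq hv] at hp hq
  exact hpq.1 (hp.trans hq.symm)

/-- The reflection in an edge vector whose orthogonal hyperplane separates the ends of an edge
exchanges these ends. -/
theorem InscribedBipartite.hyperplaneReflection_eq_of_inner_mul_inner_neg [FiniteDimensional ℝ E]
    (H : InscribedBipartite V r ℓ col) {e a b : E} (he : IsEdgeVec V e) (hab : Adj V a b)
    (h : ⟪e, a⟫ * ⟪e, b⟫ < 0) : hyperplaneReflection e a = b := by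
  obtain ⟨-, c, hc⟩ := id hab
  have ha : a ∈ face V c := hc ▸ mem_insert _ _
  have hb : b ∈ face V c := hc ▸ mem_insert_of_mem _ rfl
  set R := hyperplaneReflection e with hR
  have hx : R (⟪e, b⟫ • a - ⟪e, a⟫ • b) = ⟪e, b⟫ • a - ⟪e, a⟫ • b := by
    apply hyperplaneReflection_of_inner_eq_zero
    rw [inner_sub_right, inner_smul_right, inner_smul_right]
    ring
  have h1 : ⟪e, b⟫ * (⟪c, R a⟫ - ⟪c, a⟫) = ⟪e, a⟫ * (⟪c, R b⟫ - ⟪c, a⟫) := by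
    have := congrArg (fun y => ⟪c, y⟫) hx
    simp only [map_sub, map_smul, inner_sub_right, inner_smul_right] at this
    linear_combination this + ⟪e, a⟫ * inner_eq_of_mem_face ha hb
  have hRa := ha.2 _ (H.hyperplaneReflection_mem he ha.1)
  have hRb := ha.2 _ (H.hyperplaneReflection_mem he hb.1)
  have heq : ⟪c, R a⟫ = ⟪c, a⟫ := by
    rcases mul_neg_iff.1 h with ⟨h2, h3⟩ | ⟨h2, h3⟩ <;> nlinarith
  have hmem : R a ∈ face V c :=
    ⟨H.hyperplaneReflection_mem he ha.1, fun w hw => (ha.2 w hw).trans heq.ge⟩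
  rw [hc] at hmem
  rcases hmem with h2 | h2
  · have h3 : ⟪e, a⟫ = -⟪e, a⟫ := by
      conv_lhs => rw [← h2]
      rw [← inner_hyperplaneReflection, hyperplaneReflection_self, inner_neg_left]
    have h4 : ⟪e, a⟫ = 0 := by linarith
    rw [h4, zero_mul] at h
    exact absurd h (lt_irrefl _)
  · exact h2

theorem hyperplaneReflection_eq_of_apply_eq {e a b : E} (hab : a ≠ b)
    (h : hyperplaneReflection e a = b) : hyperplaneReflection (a - b) = hyperplaneReflection e := by
  have h1 : a - b = (2 * ⟪e, a⟫ / ⟪e, e⟫) • e := by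
    rw [← h, hyperplaneReflection_apply, sub_sub_cancel]
  rw [h1]
  refine hyperplaneReflection_smul (fun h0 => hab ?_) e
  rwa [h0, zero_smul, sub_eq_zero] at h1

theorem hyperplaneReflection_mul_self (u : E) :
    hyperplaneReflection u * hyperplaneReflection u = 1 :=
  LinearIsometryEquiv.ext (hyperplaneReflection_hyperplaneReflection u)

theorem hyperplaneReflection_map_mul (g : E ≃ₗᵢ[ℝ] E) (u : E) :
    hyperplaneReflection (g u) * g = g * hyperplaneReflection u := by
  ext x
  change hyperplaneReflection (g u) (g x) = g (hyperplaneReflection u x)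
  rw [hyperplaneReflection_apply, hyperplaneReflection_apply, g.inner_map_map, g.inner_map_map,
    map_sub, map_smul]

/-- The reflections exchanging `v₀` with the other end of an edge at `v₀`. -/
def edgeReflections (V : Set E) (v₀ : E) : Set (E ≃ₗᵢ[ℝ] E) :=
  (fun w => hyperplaneReflection (v₀ - w)) '' {w | Adj V v₀ w}

namespace InscribedBipartite

variable [FiniteDimensional ℝ E] {v₀ : E}

theorem apply_mem_iff (H : InscribedBipartite V r ℓ col) {T : E ≃ₗᵢ[ℝ] E}
    (hT : T ∈ Subgroup.closure (edgeReflections V v₀)) : ∀ v, T v ∈ V ↔ v ∈ V := by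
  induction hT using Subgroup.closure_induction with
  | mem s hs =>
    obtain ⟨w, hw, rfl⟩ := hs
    have h : ∀ v ∈ V, hyperplaneReflection (v₀ - w) v ∈ V :=
      fun v hv => H.hyperplaneReflection_mem ⟨v₀, w, hw, rfl⟩ hv
    exact fun v => ⟨fun hv => by simpa using h _ hv, h v⟩
  | one => exact fun v => Iff.rfl
  | mul S T _ _ hS hT => exact fun v => (hS (T v)).trans (hT v)
  | inv T _ hT =>
    intro v
    rw [← hT, show T (T⁻¹ v) = v from T.apply_symm_apply v]

omit [FiniteDimensional ℝ E] in
theorem hyperplaneReflection_sub_apply (H : InscribedBipartite V r ℓ col) {v w : E}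
    (h : Adj V v w) : hyperplaneReflection (v - w) v = w :=
  hyperplaneReflection_sub (by rw [H.norm_eq v h.left_mem, H.norm_eq w h.right_mem])

/-- An edge vector separating `v₀` from its image under a word in the edge reflections reflects
this word to a shorter one. -/
theorem exists_shorter_word (H : InscribedBipartite V r ℓ col) {e : E} (he : IsEdgeVec V e)
    (hpos : 0 < ⟪e, v₀⟫) (l : List (E ≃ₗᵢ[ℝ] E)) (hl : ∀ s ∈ l, s ∈ edgeReflections V v₀)
    (hneg : ⟪e, l.prod v₀⟫ < 0) :
    ∃ l' : List (E ≃ₗᵢ[ℝ] E), (∀ s ∈ l', s ∈ edgeReflections V v₀) ∧ l'.length < l.length ∧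
      hyperplaneReflection e * l.prod = l'.prod := by
  induction l using List.reverseRecOn with
  | nil => exact absurd hneg (not_lt.2 (by simpa using hpos.le))
  | append_singleton l s ih =>
    have hl' : ∀ s ∈ l, s ∈ edgeReflections V v₀ := fun t ht => hl t (by simp [ht])
    have hs : s ∈ edgeReflections V v₀ := hl s (by simp)
    have hprod : (l ++ [s]).prod = l.prod * s := by simp
    rw [hprod] at hneg ⊢
    by_cases hlneg : ⟪e, l.prod v₀⟫ < 0
    · obtain ⟨l', h1, h2, h3⟩ := ih hl' hlneg
      refine ⟨l' ++ [s], fun t ht => ?_, by simpa using h2, ?_⟩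
      · rcases List.mem_append.1 ht with ht | ht
        · exact h1 t ht
        · rwa [List.mem_singleton.1 ht]
      · rw [← mul_assoc, h3]
        simp
    · have hmem : l.prod ∈ Subgroup.closure (edgeReflections V v₀) :=
        Subgroup.list_prod_mem _ fun t ht => Subgroup.subset_closure (hl' t ht)
      obtain ⟨w, hw, rfl⟩ := hs
      have hne := H.inner_ne_zero he ((H.apply_mem_iff hmem v₀).2 hw.left_mem)
      have hadj := hw.map l.prod (H.apply_mem_iff hmem)
      rw [LinearIsometryEquiv.coe_mul, Function.comp_apply, H.hyperplaneReflection_sub_apply hw] at hneg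
      have hcross := H.hyperplaneReflection_eq_of_inner_mul_inner_neg he hadj
        (mul_neg_of_pos_of_neg (lt_of_le_of_ne (not_lt.1 hlneg) hne.symm) hneg)
      refine ⟨l, hl', by simp, ?_⟩
      rw [← hyperplaneReflection_eq_of_apply_eq hadj.1 hcross, ← map_sub, ← mul_assoc,
        hyperplaneReflection_map_mul, mul_assoc, hyperplaneReflection_mul_self, mul_one]

theorem list_prod_eq_one (H : InscribedBipartite V r ℓ col) (l : List (E ≃ₗᵢ[ℝ] E))
    (hl : ∀ s ∈ l, s ∈ edgeReflections V v₀) (hfix : l.prod v₀ = v₀) : l.prod = 1 := by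
  induction hn : l.length using Nat.strong_induction_on generalizing l with
  | _ n ih =>
    subst hn
    rcases l with _ | ⟨s, l⟩
    · exact List.prod_nil
    obtain ⟨w, hw, rfl⟩ := hl s (by simp)
    have hl' : ∀ s ∈ l, s ∈ edgeReflections V v₀ := fun t ht => hl t (by simp [ht])
    have hsub := H.hyperplaneReflection_sub_apply hw
    rw [List.prod_cons] at hfix ⊢
    have hlw : l.prod v₀ = w := by
      have h : hyperplaneReflection (v₀ - w) (l.prod v₀) = v₀ := hfix
      rw [← hyperplaneReflection_hyperplaneReflection (v₀ - w) (l.prod v₀), h, hsub]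
    have hanti : ⟪v₀ - w, w⟫ = -⟪v₀ - w, v₀⟫ := by
      nth_rw 2 [← hsub]
      rw [← inner_hyperplaneReflection, hyperplaneReflection_self, inner_neg_left]
    have hpos : 0 < ⟪v₀ - w, v₀⟫ := by
      have h1 := real_inner_self_pos.2 (sub_ne_zero.2 hw.1)
      rw [inner_sub_right, hanti] at h1
      linarith
    obtain ⟨l', h1, h2, h3⟩ := H.exists_shorter_word ⟨v₀, w, hw, rfl⟩ hpos l hl'
      (by rw [hlw, hanti]; linarith)
    rw [h3] at hfix ⊢
    exact ih l'.length (by simp; omega) l' h1 hfix rfl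

theorem eq_one_of_apply_eq (H : InscribedBipartite V r ℓ col) {T : E ≃ₗᵢ[ℝ] E}
    (hT : T ∈ Subgroup.closure (edgeReflections V v₀)) (hfix : T v₀ = v₀) : T = 1 := by
  rw [← Subgroup.mem_toSubmonoid, Subgroup.closure_toSubmonoid] at hT
  obtain ⟨l, hl, rfl⟩ := Submonoid.exists_list_of_mem_closure hT
  refine H.list_prod_eq_one l (fun s hs => ?_) hfix
  rcases hl s hs with h | ⟨w, hw, h⟩
  · exact h
  · refine ⟨w, hw, ?_⟩
    refine inv_injective ?_
    rw [← h]
    exact inv_eq_of_mul_eq_one_left (hyperplaneReflection_mul_self _)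

theorem finite_closure (H : InscribedBipartite V r ℓ col) (hv₀ : v₀ ∈ V) :
    (Subgroup.closure (edgeReflections V v₀) : Set (E ≃ₗᵢ[ℝ] E)).Finite := by
  refine Set.Finite.of_finite_image (f := fun T => T v₀) (H.finite.subset ?_) ?_
  · rintro _ ⟨T, hT, rfl⟩
    exact (H.apply_mem_iff hT v₀).2 hv₀
  · intro S hS T hT hST
    rw [← inv_mul_eq_one]
    refine H.eq_one_of_apply_eq (mul_mem (inv_mem hS) hT) ?_
    rw [LinearIsometryEquiv.coe_mul, Function.comp_apply, ← show S v₀ = T v₀ from hST]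
    exact S.symm_apply_apply v₀

theorem exists_apply_eq_of_adj (H : InscribedBipartite V r ℓ col) {v w : E} (hvw : Adj V v w)
    (h : ∃ T ∈ Subgroup.closure (edgeReflections V v₀), v = T v₀) :
    ∃ T ∈ Subgroup.closure (edgeReflections V v₀), w = T v₀ := by
  obtain ⟨T, hT, rfl⟩ := h
  have hadj := hvw.map T⁻¹ (H.apply_mem_iff (inv_mem hT))
  rw [show T⁻¹ (T v₀) = v₀ from T.symm_apply_apply v₀] at hadj
  refine ⟨T * hyperplaneReflection (v₀ - T⁻¹ w),
    mul_mem hT (Subgroup.subset_closure ⟨_, hadj, rfl⟩), ?_⟩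
  rw [LinearIsometryEquiv.coe_mul, Function.comp_apply, H.hyperplaneReflection_sub_apply hadj]
  exact (T.apply_symm_apply w).symm

/-- The group generated by the edge reflections at `v₀` acts transitively. -/
theorem exists_apply_eq (H : InscribedBipartite V r ℓ col) (hv₀ : v₀ ∈ V) {v : E} (hv : v ∈ V) :
    ∃ T ∈ Subgroup.closure (edgeReflections V v₀), v = T v₀ := by
  set A : Set E := (V - V) \ {0} with hA
  have hAfin : A.Finite := (H.finite.sub H.finite).subset sdiff_subset
  have hA0 : (0 : E) ∉ A := by simp [hA]
  have hmem : ∀ {c p q : E}, p ∈ face V c → q ∈ face V c → p ≠ q → p - q ∈ A :=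
    fun hp hq h => ⟨sub_mem_sub hp.1 hq.1, sub_ne_zero.2 h⟩
  set O : Set E := {w | ∃ T ∈ Subgroup.closure (edgeReflections V v₀), w = T v₀} with hO
  have hloc : ∀ c, (∀ a ∈ A, ∀ b ∈ A, ⟪a, c⟫ = 0 → ⟪b, c⟫ = 0 → ∃ t : ℝ, b = t • a) →
      (∀ᶠ y in 𝓝 c, Avoids A y → face V y ⊆ O) ∨
        (∀ᶠ y in 𝓝 c, Avoids A y → ¬ face V y ⊆ O) := by
    intro c hc
    have hsub := eventually_face_subset H.finite c
    by_cases hF : face V c ⊆ O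
    · exact Or.inl (hsub.mono fun y hy _ => hy.trans hF)
    · right
      have hdisj : ∀ p ∈ face V c, p ∉ O := by
        intro p hp hpO
        obtain ⟨q, hq, hqO⟩ := not_subset.1 hF
        have hpq : p ≠ q := fun h => hqO (h ▸ hpO)
        refine hqO (H.exists_apply_eq_of_adj ⟨hpq, c, ?_⟩ hpO)
        refine face_eq_pair (u := p - q) H.norm_eq (fun a ha b hb => ?_) hp hq hpq
        by_cases hab : a = b
        · exact ⟨0, by simp [hab]⟩
        · exact hc _ (hmem hp hq hpq) _ (hmem ha hb hab) (inner_sub_eq_zero_of_mem_face hp hq)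
            (inner_sub_eq_zero_of_mem_face ha hb)
      filter_upwards [hsub] with y hy _ hyO
      obtain ⟨p, hp⟩ := face_nonempty H.finite ⟨v, hv⟩ y
      exact hdisj p (hy hp) (hyO hp)
  obtain ⟨c₁, hc₁, hc₁A⟩ := exists_avoids_of_eventually hAfin hA0 (eventually_face_subset H.finite v₀)
  obtain ⟨c₂, hc₂, hc₂A⟩ := exists_avoids_of_eventually hAfin hA0 (eventually_face_subset H.finite v)
  rw [face_self H.norm_eq hv₀] at hc₁
  rw [face_self H.norm_eq hv] at hc₂
  have hc₁O : face V c₁ ⊆ O := hc₁.trans (singleton_subset_iff.2 ⟨1, one_mem _, rfl⟩)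
  obtain ⟨w, hw⟩ := face_nonempty H.finite ⟨v, hv⟩ c₂
  have hwO := avoids_induction hAfin hA0 (fun c => face V c ⊆ O) hloc hc₁A hc₁O hc₂A hw
  rwa [hc₂ hw] at hwO

end InscribedBipartite

end Symmetry

section Polytope

variable {E : Type*} [NormedAddCommGroup E] [InnerProductSpace ℝ E]

theorem convexHull_extremePoints_of_finite {P : Set E} (hP : IsCompact P) (hconv : Convex ℝ P)
    (hfin : (P.extremePoints ℝ).Finite) : convexHull ℝ (P.extremePoints ℝ) = P := by
  rw [← (hfin.isClosed_convexHull ℝ).closure_eq, closure_convexHull_extremePoints hP hconv]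

/-- An edge of the vertex set of a polytope is an exposed segment. -/
theorem Adj.isExposed_segment {P : Set E} (hP : IsCompact P) (hconv : Convex ℝ P) {v w : E}
    (h : Adj (P.extremePoints ℝ) v w) (hfin : (P.extremePoints ℝ).Finite) :
    IsExposed ℝ P (segment ℝ v w) := by
  obtain ⟨-, c, hc⟩ := h
  set B : Set E := {x ∈ P | ∀ y ∈ P, innerSL ℝ c y ≤ innerSL ℝ c x} with hB
  have hexp : IsExposed ℝ P B := fun _ => ⟨innerSL ℝ c, rfl⟩
  have hsub : ∀ x ∈ P.extremePoints ℝ, x ∈ B ↔ x ∈ face (P.extremePoints ℝ) c := by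
    intro x hx
    refine ⟨fun h => ⟨hx, fun y hy => h.2 y hy.1⟩, fun h => ⟨hx.1, fun y hy => ?_⟩⟩
    have hhalf : Convex ℝ {z : E | innerSL ℝ c z ≤ innerSL ℝ c x} :=
      convex_halfSpace_le (innerSL ℝ c).toLinearMap.isLinear _
    rw [← convexHull_extremePoints_of_finite hP hconv hfin] at hy
    exact convexHull_min (fun z hz => h.2 z hz) hhalf hy
  have hext : B.extremePoints ℝ = {v, w} := by
    rw [← hc, hexp.isExtreme.extremePoints_eq]
    ext x
    constructor
    · rintro ⟨h1, h2⟩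
      exact (hsub x h2).1 h1
    · intro h
      exact ⟨(hsub x h.1).2 h, h.1⟩
  have hBc : IsCompact B := hexp.isCompact hP
  have : B = segment ℝ v w := by
    rw [← closure_convexHull_extremePoints hBc (hexp.convex hconv), hext,
      ((toFinite _).isClosed_convexHull ℝ).closure_eq, convexHull_pair]
  rwa [← this]

end Polytope

theorem isLinearReflection_hyperplaneReflection {d : ℕ} {u : Euc d} (hu : u ≠ 0) :
    IsLinearReflection (hyperplaneReflection u) := by
  refine ⟨fun h => hu ?_, hyperplaneReflection_mul_self u, ?_⟩
  · have := congrArg (fun T : Euc d ≃ₗᵢ[ℝ] Euc d => T u) h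
    simp only [hyperplaneReflection_self, LinearIsometryEquiv.coe_one, id_eq] at this
    rw [neg_eq_iff_add_eq_zero, ← two_smul ℝ u, smul_eq_zero] at this
    exact this.resolve_left two_ne_zero
  · have hker : LinearMap.ker (((hyperplaneReflection u).toLinearEquiv : Euc d →ₗ[ℝ] Euc d) -
        LinearMap.id) = (ℝ ∙ u)ᗮ := by
      ext x
      rw [LinearMap.mem_ker, LinearMap.sub_apply, sub_eq_zero]
      exact Submodule.reflection_eq_self_iff x
    have hsum := (ℝ ∙ u).finrank_add_finrank_orthogonal
    rw [finrank_span_singleton hu, finrank_euclideanSpace_fin] at hsum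
    rw [hker]
    omega

theorem isFiniteReflectionGroup_closure {d : ℕ} {s : Set (Euc d ≃ₗᵢ[ℝ] Euc d)}
    (hs : ∀ R ∈ s, IsLinearReflection R)
    (hfin : (Subgroup.closure s : Set (Euc d ≃ₗᵢ[ℝ] Euc d)).Finite) :
    IsFiniteReflectionGroup (Subgroup.closure s) :=
  ⟨hfin, le_antisymm
    (Subgroup.closure_mono fun R hR => ⟨hs R hR, Subgroup.subset_closure hR⟩)
    ((Subgroup.closure_le _).2 fun _ hR => hR.2)⟩

/-- A full-dimensional bipartite polytope in dimension `d ≥ 2` whose two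
radii coincide is a `Γ`-permutahedron for some finite reflection group `Γ`. -/
theorem bipartite_equal_radii_is_permutahedron {d : ℕ} (hd : 2 ≤ d)
    (P V1 V2 : Set (Euc d)) (r ℓ : ℝ)
    (hP : IsPolytope P) (hfull : FullDim P)
    (hbip : IsBipartiteWith P V1 V2 r r ℓ) :
    IsPermutahedron P := by
  obtain ⟨s, rfl⟩ := hP
  set P := convexHull ℝ (s : Set (Euc d))
  have hcomp : IsCompact P := s.finite_toSet.isCompact_convexHull ℝ
  have hconv : Convex ℝ P := convex_convexHull ℝ _
  set V := P.extremePoints ℝ with hV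
  have hVfin : V.Finite := s.finite_toSet.subset extremePoints_convexHull_subset
  have hhull : P = convexHull ℝ V := (convexHull_extremePoints_of_finite hcomp hconv hVfin).symm
  obtain ⟨-, hlen, hunion, hdisj, hedge, -, -, hr1, hr2⟩ := hbip
  have hadj : ∀ v w, Adj V v w → IsEdge P v w := fun v w h =>
    ⟨h.1, h.isExposed_segment hcomp hconv hVfin⟩
  have H : InscribedBipartite V r ℓ V1 :=
    { finite := hVfin
      norm_eq := fun v hv => by
        rw [hV, ← hunion] at hv
        exact hv.elim (hr1 v) (hr2 v)
      norm_sub_eq := fun v w h => hlen v w (hadj v w h)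
      mem_iff := fun v w h => by
        rcases hedge v w (hadj v w h) with ⟨h1, h2⟩ | ⟨h1, h2⟩
        · exact ⟨fun _ h3 => hdisj.notMem_of_mem_left h3 h2, fun _ => h1⟩
        · exact ⟨fun h3 => absurd h1 (hdisj.notMem_of_mem_left h3), fun h3 => absurd h2 h3⟩ }
  have hPne : P.Nonempty := by
    rw [← affineSpan_nonempty (k := ℝ), hfull]
    exact univ_nonempty
  obtain ⟨v₀, hv₀⟩ := hcomp.extremePoints_nonempty hPne
  refine ⟨Subgroup.closure (edgeReflections V v₀), v₀,
    isFiniteReflectionGroup_closure ?_ (H.finite_closure hv₀),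
    fun T hT hT1 h => hT1 (H.eq_one_of_apply_eq hT h), ?_⟩
  · rintro _ ⟨w, hw, rfl⟩
    exact isLinearReflection_hyperplaneReflection (sub_ne_zero.2 hw.1)
  · rw [hhull]
    congr 1
    ext v
    constructor
    · exact H.exists_apply_eq hv₀
    · rintro ⟨T, hT, rfl⟩
      exact (H.apply_mem_iff hT v₀).2 hv₀
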